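/- The series ∑_{k=1}^∞ h_k^{(2)}·h_k²/k² converges and equals (135/64)·ζ(6) + (7/8)·ζ(3)². -/

import Mathlib

open Finset Real

noncomputable def H (k : ℕ) : ℝ := ∑ j ∈ Finset.range k, (1 : ℝ) / ((j : ℝ) + 1)
noncomputable def H2 (k : ℕ) : ℝ := ∑ j ∈ Finset.range k, (1 : ℝ) / ((j : ℝ) + 1) ^ 2
noncomputable def H3 (k : ℕ) : ℝ := ∑ j ∈ Finset.range k, (1 : ℝ) / ((j : ℝ) + 1) ^ 3
noncomputable def h (k : ℕ) : ℝ := ∑ j ∈ Finset.range k, (1 : ℝ) / (2 * (j : ℝ) + 1)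
noncomputable def h2 (k : ℕ) : ℝ := ∑ j ∈ Finset.range k, (1 : ℝ) / (2 * (j : ℝ) + 1) ^ 2
noncomputable def h3 (k : ℕ) : ℝ := ∑ j ∈ Finset.range k, (1 : ℝ) / (2 * (j : ℝ) + 1) ^ 3
noncomputable def zeta (s : ℕ) : ℝ := ∑' n : ℕ, (1 : ℝ) / ((n : ℝ) + 1) ^ s

theorem HasSum.of_eq {f g : ℕ → ℝ} {a b : ℝ} (hf : HasSum f a) (hfg : ∀ n, g n = f n)
    (hab : b = a) : HasSum g b := by
  rwa [hab, funext hfg]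

theorem hasSum_swap_of_nonneg {f : ℕ → ℕ → ℝ} {r c : ℕ → ℝ} {s : ℝ}
    (hf : ∀ m n, 0 ≤ f m n) (hr : ∀ m, HasSum (f m) (r m))
    (hc : ∀ n, HasSum (fun m => f m n) (c n)) (hs : HasSum r s) : HasSum c s := by
  have hsum : Summable (fun p : ℕ × ℕ => f p.1 p.2) := by
    rw [summable_prod_of_nonneg (fun p => hf p.1 p.2)]
    refine ⟨fun m => (hr m).summable, ?_⟩
    simpa only [(hr _).tsum_eq] using hs.summable
  have h1 : HasSum r (∑' p : ℕ × ℕ, f p.1 p.2) := hsum.hasSum.prod_fiberwise hr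
  have h3 : HasSum (fun p : ℕ × ℕ => f p.2 p.1) (∑' p : ℕ × ℕ, f p.1 p.2) :=
    (Equiv.prodComm ℕ ℕ).hasSum_iff.mpr hsum.hasSum
  have h2 := h3.prod_fiberwise hc
  rwa [hs.unique h1]

theorem hasSum_ite_lt {g : ℕ → ℝ} {s : ℝ} (m : ℕ) (hg : HasSum (fun d => g (m + 1 + d)) s) :
    HasSum (fun n => if m < n then g n else 0) s := by
  rw [← hasSum_nat_add_iff' (m + 1), Finset.sum_eq_zero, sub_zero]
  · have e : (fun d => if m < d + (m + 1) then g (d + (m + 1)) else 0)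
        = fun d => g (m + 1 + d) := by
      ext d
      rw [if_pos (by omega), add_comm d]
    rwa [e]
  · intro i hi
    rw [if_neg]
    simpa [Nat.lt_succ_iff] using hi

/-- Exchange of summation over the triangle `m < n`. -/
theorem hasSum_triangle {f : ℕ → ℕ → ℝ} {r : ℕ → ℝ} {s : ℝ}
    (hf : ∀ m n, m < n → 0 ≤ f m n) (hr : ∀ m, HasSum (fun d => f m (m + 1 + d)) (r m))
    (hs : HasSum r s) : HasSum (fun n => ∑ m ∈ Finset.range n, f m n) s := by
  refine hasSum_swap_of_nonneg (f := fun m n => if m < n then f m n else 0) (r := r) ?_ ?_ ?_ hs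
  · intro m n
    split_ifs with hmn
    · exact hf m n hmn
    · exact le_rfl
  · intro m
    exact hasSum_ite_lt m (hr m)
  · intro n
    have : HasSum (fun m => if m < n then f m n else 0) _ := hasSum_sum_of_ne_finset_zero
      (s := Finset.range n) (by intro b hb; rw [if_neg]; simpa using hb)
    convert this using 1
    exact Finset.sum_congr rfl fun m hm => by rw [if_pos (Finset.mem_range.mp hm)]

/-- The converse exchange: from finite columns to rows. -/
theorem hasSum_triangle_symm {f : ℕ → ℕ → ℝ} {r : ℕ → ℝ} {s : ℝ}
    (hf : ∀ m n, m < n → 0 ≤ f m n) (hr : ∀ m, HasSum (fun d => f m (m + 1 + d)) (r m))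
    (hs : HasSum (fun n => ∑ m ∈ Finset.range n, f m n) s) : HasSum r s := by
  refine hasSum_swap_of_nonneg (f := fun n m => if m < n then f m n else 0)
    (r := fun n => ∑ m ∈ Finset.range n, f m n) ?_ ?_ ?_ hs
  · intro n m
    split_ifs with hmn
    · exact hf m n hmn
    · exact le_rfl
  · intro n
    have : HasSum (fun m => if m < n then f m n else 0) _ := hasSum_sum_of_ne_finset_zero
      (s := Finset.range n) (by intro b hb; rw [if_neg]; simpa using hb)
    convert this using 1
    exact Finset.sum_congr rfl fun m hm => by rw [if_pos (Finset.mem_range.mp hm)]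
  · intro m
    exact hasSum_ite_lt m (hr m)

theorem hasSum_of_telescope {g f : ℕ → ℝ} {l : ℝ} (hg : ∀ n, f n = g n - g (n + 1))
    (hf : ∀ n, 0 ≤ f n) (hl : Filter.Tendsto g Filter.atTop (nhds l)) : HasSum f (g 0 - l) := by
  rw [hasSum_iff_tendsto_nat_of_nonneg hf]
  have : (fun n => ∑ i ∈ Finset.range n, f i) = fun n => g 0 - g n := by
    ext n
    rw [← Finset.sum_range_sub' g n]
    exact Finset.sum_congr rfl fun i _ => hg i
  rw [this]
  exact tendsto_const_nhds.sub hl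

noncomputable def h4 (k : ℕ) : ℝ := ∑ j ∈ Finset.range k, (1 : ℝ) / (2 * (j : ℝ) + 1) ^ 4

theorem h_succ (k : ℕ) : h (k + 1) = h k + 1 / (2 * (k : ℝ) + 1) := Finset.sum_range_succ _ _
theorem h2_succ (k : ℕ) : h2 (k + 1) = h2 k + 1 / (2 * (k : ℝ) + 1) ^ 2 :=
  Finset.sum_range_succ _ _
theorem h3_succ (k : ℕ) : h3 (k + 1) = h3 k + 1 / (2 * (k : ℝ) + 1) ^ 3 :=
  Finset.sum_range_succ _ _
theorem h4_succ (k : ℕ) : h4 (k + 1) = h4 k + 1 / (2 * (k : ℝ) + 1) ^ 4 :=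
  Finset.sum_range_succ _ _
theorem H_succ (k : ℕ) : H (k + 1) = H k + 1 / ((k : ℝ) + 1) := Finset.sum_range_succ _ _
@[simp] theorem h_zero : h 0 = 0 := Finset.sum_range_zero _
@[simp] theorem h2_zero : h2 0 = 0 := Finset.sum_range_zero _
@[simp] theorem h3_zero : h3 0 = 0 := Finset.sum_range_zero _
@[simp] theorem h4_zero : h4 0 = 0 := Finset.sum_range_zero _
@[simp] theorem H_zero : H 0 = 0 := Finset.sum_range_zero _

theorem h_nonneg (k : ℕ) : 0 ≤ h k := Finset.sum_nonneg fun _ _ => by positivity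
theorem h2_nonneg (k : ℕ) : 0 ≤ h2 k := Finset.sum_nonneg fun _ _ => by positivity
theorem h3_nonneg (k : ℕ) : 0 ≤ h3 k := Finset.sum_nonneg fun _ _ => by positivity
theorem h4_nonneg (k : ℕ) : 0 ≤ h4 k := Finset.sum_nonneg fun _ _ => by positivity
theorem H_nonneg (k : ℕ) : 0 ≤ H k := Finset.sum_nonneg fun _ _ => by positivity

theorem h_sq_le (k : ℕ) : h k ^ 2 ≤ k := by
  induction k with
  | zero => simp
  | succ k ih =>
    rw [h_succ]
    push_cast
    rcases Nat.eq_zero_or_pos k with rfl | hk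
    · simp
    have hk' : (1 : ℝ) ≤ k := by exact_mod_cast hk
    have h1 : 2 * h k ≤ k + 1 := by nlinarith [sq_nonneg (h k - 1)]
    have h2 : 2 * h k * (1 / (2 * (k : ℝ) + 1)) ≤ (k + 1) * (1 / (2 * (k : ℝ) + 1)) := by gcongr
    have h3 : (k + 1) * (1 / (2 * (k : ℝ) + 1)) + (1 / (2 * (k : ℝ) + 1)) ^ 2 ≤ 1 := by
      have : (0 : ℝ) < 2 * k + 1 := by positivity
      rw [div_pow, ← sub_nonneg]
      have e : 1 - ((k + 1) * (1 / (2 * (k : ℝ) + 1)) + 1 ^ 2 / (2 * (k : ℝ) + 1) ^ 2)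
        = (2 * k ^ 2 + k - 1) / (2 * (k : ℝ) + 1) ^ 2 := by field_simp; ring
      rw [e]
      apply div_nonneg <;> nlinarith
    nlinarith

theorem h2_le (k : ℕ) : h2 k ≤ 2 := by
  have key : ∀ k : ℕ, h2 (k + 1) ≤ 2 - 1 / (2 * (k : ℝ) + 1) := by
    intro k
    induction k with
    | zero => simp [h2_succ]; norm_num
    | succ k ih =>
      rw [h2_succ]
      push_cast
      have e : 1 / (2 * ((k : ℝ) + 1) + 1) ^ 2 ≤ 1 / (2 * (k : ℝ) + 1) - 1 / (2 * ((k : ℝ) + 1) + 1) := by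
        rw [div_sub_div _ _ (by positivity) (by positivity), div_le_div_iff₀ (by positivity) (by positivity)]
        have : (0 : ℝ) ≤ k := by positivity
        nlinarith [mul_nonneg this this, mul_nonneg this (mul_nonneg this this)]
      linarith
  rcases k with _ | k
  · simp
  · refine (key k).trans ?_
    have : (0 : ℝ) ≤ 1 / (2 * (k : ℝ) + 1) := by positivity
    linarith

theorem h3_le_h2 (k : ℕ) : h3 k ≤ h2 k := by
  refine Finset.sum_le_sum fun j _ => ?_
  apply one_div_le_one_div_of_le (by positivity)
  exact pow_le_pow_right₀ (by have : (0 : ℝ) ≤ j := by positivity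
                              linarith) (by norm_num)

theorem h4_le_h2 (k : ℕ) : h4 k ≤ h2 k := by
  refine Finset.sum_le_sum fun j _ => ?_
  apply one_div_le_one_div_of_le (by positivity)
  exact pow_le_pow_right₀ (by have : (0 : ℝ) ≤ j := by positivity
                              linarith) (by norm_num)

theorem h2_le_h (k : ℕ) : h2 k ≤ h k := by
  refine Finset.sum_le_sum fun j _ => ?_
  apply one_div_le_one_div_of_le (by positivity)
  have : (0 : ℝ) ≤ j := by positivity
  nlinarith

theorem h_le (k : ℕ) : h k ≤ k := by
  rcases k with _ | k
  · simp
  · have := h_sq_le (k + 1)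
    have h1 : (1 : ℝ) ≤ ((k + 1 : ℕ) : ℝ) := by push_cast; linarith [(by positivity : (0 : ℝ) ≤ k)]
    nlinarith [h_nonneg (k + 1)]

theorem summable_inv_succ_pow {s : ℕ} (hs : 2 ≤ s) :
    Summable fun k : ℕ => 1 / ((k : ℝ) + 1) ^ s := by
  have := (Real.summable_one_div_nat_pow (p := s)).mpr (by omega)
  simpa using (summable_nat_add_iff 1).mpr this

theorem hasSum_zeta {s : ℕ} (hs : 2 ≤ s) :
    HasSum (fun k : ℕ => 1 / ((k : ℝ) + 1) ^ s) (zeta s) :=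
  (summable_inv_succ_pow hs).hasSum

theorem zeta_two : zeta 2 = π ^ 2 / 6 := by
  refine (hasSum_zeta le_rfl).unique ?_
  have := (hasSum_nat_add_iff' 1).mpr hasSum_zeta_two
  simpa using this

theorem zeta_four : zeta 4 = π ^ 4 / 90 := by
  refine (hasSum_zeta (by norm_num)).unique ?_
  have := (hasSum_nat_add_iff' 1).mpr hasSum_zeta_four
  simpa using this

theorem hasSum_odd {s : ℕ} (hs : 2 ≤ s) :
    HasSum (fun k : ℕ => 1 / (2 * (k : ℝ) + 1) ^ s) ((1 - 1 / 2 ^ s) * zeta s) := by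
  have hz := hasSum_zeta hs
  have hodd : HasSum (fun k : ℕ => 1 / (((2 * k + 1 : ℕ) : ℝ) + 1) ^ s) (1 / 2 ^ s * zeta s) := by
    have e : (fun k : ℕ => 1 / (((2 * k + 1 : ℕ) : ℝ) + 1) ^ s)
        = fun k : ℕ => 1 / 2 ^ s * (1 / ((k : ℝ) + 1) ^ s) := by
      ext k
      rw [one_div_mul_one_div, ← mul_pow]
      push_cast
      ring_nf
    rw [e]
    exact hz.mul_left _
  have heven : Summable (fun k : ℕ => 1 / (((2 * k : ℕ) : ℝ) + 1) ^ s) :=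
    hz.summable.comp_injective (mul_right_injective₀ two_ne_zero)
  have := (HasSum.even_add_odd (f := fun n : ℕ => 1 / ((n : ℝ) + 1) ^ s) heven.hasSum hodd).unique hz
  have e : (1 - 1 / 2 ^ s) * zeta s = ∑' k : ℕ, 1 / (((2 * k : ℕ) : ℝ) + 1) ^ s := by
    linarith
  rw [e]
  convert heven.hasSum using 3
  push_cast
  rfl

theorem hasSum_odd_mul_odd {a b : ℕ} (ha : 2 ≤ a) (hb : 2 ≤ b) :
    HasSum (fun n : ℕ => ∑ i ∈ range (n + 1),
      1 / (2 * (i : ℝ) + 1) ^ a * (1 / (2 * ((n - i : ℕ) : ℝ) + 1) ^ b))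
      (((1 - 1 / 2 ^ a) * zeta a) * ((1 - 1 / 2 ^ b) * zeta b)) := by
  have h1 := hasSum_odd ha
  have h2 := hasSum_odd hb
  rw [← h1.tsum_eq, ← h2.tsum_eq]
  exact hasSum_sum_range_mul_of_summable_norm (f := fun k : ℕ => 1 / (2 * (k : ℝ) + 1) ^ a)
    (g := fun k : ℕ => 1 / (2 * (k : ℝ) + 1) ^ b) h1.summable.norm h2.summable.norm

theorem sum_odd_reflect (n : ℕ) (g : ℝ → ℝ) :
    ∑ i ∈ range (n + 1), g ((n - i : ℕ) : ℝ) = ∑ i ∈ range (n + 1), g (i : ℝ) :=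
  Finset.sum_range_reflect (fun i : ℕ => g (i : ℝ)) (n + 1)

theorem hasSum_shuffle_two_two :
    HasSum (fun k : ℕ => h2 (k + 1) / (2 * ((k : ℝ) + 1) ^ 2) + h (k + 1) / (2 * ((k : ℝ) + 1) ^ 3))
      ((3 / 4 * zeta 2) ^ 2) := by
  have := hasSum_odd_mul_odd (a := 2) (b := 2) le_rfl le_rfl
  convert this using 1
  · ext k
    have r1 := sum_odd_reflect k (fun x => 1 / (2 * x + 1))
    have r2 := sum_odd_reflect k (fun x => 1 / (2 * x + 1) ^ 2)
    have e : ∀ i ∈ range (k + 1), 1 / (2 * (i : ℝ) + 1) ^ 2 * (1 / (2 * ((k - i : ℕ) : ℝ) + 1) ^ 2)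
      = (1 / (2 * ((k : ℝ) + 1)) ^ 2) *
          (1 / (2 * (i : ℝ) + 1) ^ 2 + 1 / (2 * ((k - i : ℕ) : ℝ) + 1) ^ 2)
        + (2 / (2 * ((k : ℝ) + 1)) ^ 3) *
          (1 / (2 * (i : ℝ) + 1) + 1 / (2 * ((k - i : ℕ) : ℝ) + 1)) := by
      intro i hi
      have hk : (k : ℝ) + 1 = ((2 * (i : ℝ) + 1) + (2 * ((k - i : ℕ) : ℝ) + 1)) / 2 := by
        rw [Nat.cast_sub (by simpa [Nat.lt_succ_iff] using hi)]; ring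
      rw [hk]
      generalize hp : 2 * (i : ℝ) + 1 = p
      generalize hq : 2 * ((k - i : ℕ) : ℝ) + 1 = q
      have : 0 < p := by rw [← hp]; positivity
      have : 0 < q := by rw [← hq]; positivity
      field_simp
      ring
    rw [Finset.sum_congr rfl e]
    simp only [Finset.sum_add_distrib, ← Finset.mul_sum]
    rw [r1, r2, h, h2]
    field_simp
    ring
  · norm_num
    ring

theorem hasSum_shuffle_three_three :
    HasSum (fun k : ℕ => h3 (k + 1) / (4 * ((k : ℝ) + 1) ^ 3)
        + 3 * h2 (k + 1) / (8 * ((k : ℝ) + 1) ^ 4) + 3 * h (k + 1) / (8 * ((k : ℝ) + 1) ^ 5))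
      ((7 / 8 * zeta 3) ^ 2) := by
  have := hasSum_odd_mul_odd (a := 3) (b := 3) (by norm_num) (by norm_num)
  convert this using 1
  · ext k
    have r1 := sum_odd_reflect k (fun x => 1 / (2 * x + 1))
    have r2 := sum_odd_reflect k (fun x => 1 / (2 * x + 1) ^ 2)
    have r3 := sum_odd_reflect k (fun x => 1 / (2 * x + 1) ^ 3)
    have e : ∀ i ∈ range (k + 1), 1 / (2 * (i : ℝ) + 1) ^ 3 * (1 / (2 * ((k - i : ℕ) : ℝ) + 1) ^ 3)
      = (1 / (2 * ((k : ℝ) + 1)) ^ 3) *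
          (1 / (2 * (i : ℝ) + 1) ^ 3 + 1 / (2 * ((k - i : ℕ) : ℝ) + 1) ^ 3)
        + (3 / (2 * ((k : ℝ) + 1)) ^ 4) *
          (1 / (2 * (i : ℝ) + 1) ^ 2 + 1 / (2 * ((k - i : ℕ) : ℝ) + 1) ^ 2)
        + (6 / (2 * ((k : ℝ) + 1)) ^ 5) *
          (1 / (2 * (i : ℝ) + 1) + 1 / (2 * ((k - i : ℕ) : ℝ) + 1)) := by
      intro i hi
      have hk : (k : ℝ) + 1 = ((2 * (i : ℝ) + 1) + (2 * ((k - i : ℕ) : ℝ) + 1)) / 2 := by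
        rw [Nat.cast_sub (by simpa [Nat.lt_succ_iff] using hi)]; ring
      rw [hk]
      generalize hp : 2 * (i : ℝ) + 1 = p
      generalize hq : 2 * ((k - i : ℕ) : ℝ) + 1 = q
      have : 0 < p := by rw [← hp]; positivity
      have : 0 < q := by rw [← hq]; positivity
      field_simp
      ring
    rw [Finset.sum_congr rfl e]
    simp only [Finset.sum_add_distrib, ← Finset.mul_sum]
    rw [r1, r2, r3, h, h2, h3]
    field_simp
    ring
  · norm_num
    ring

theorem hasSum_shuffle_two_four :
    HasSum (fun k : ℕ => h4 (k + 1) / (4 * ((k : ℝ) + 1) ^ 2) + h3 (k + 1) / (4 * ((k : ℝ) + 1) ^ 3)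
        + h2 (k + 1) / (4 * ((k : ℝ) + 1) ^ 4) + h (k + 1) / (4 * ((k : ℝ) + 1) ^ 5))
      ((3 / 4 * zeta 2) * (15 / 16 * zeta 4)) := by
  have := hasSum_odd_mul_odd (a := 2) (b := 4) (by norm_num) (by norm_num)
  convert this using 1
  · ext k
    have r1 := sum_odd_reflect k (fun x => 1 / (2 * x + 1))
    have r2 := sum_odd_reflect k (fun x => 1 / (2 * x + 1) ^ 2)
    have r3 := sum_odd_reflect k (fun x => 1 / (2 * x + 1) ^ 3)
    have r4 := sum_odd_reflect k (fun x => 1 / (2 * x + 1) ^ 4)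
    have e : ∀ i ∈ range (k + 1), 1 / (2 * (i : ℝ) + 1) ^ 2 * (1 / (2 * ((k - i : ℕ) : ℝ) + 1) ^ 4)
      = (1 / (2 * ((k : ℝ) + 1)) ^ 2) * (1 / (2 * ((k - i : ℕ) : ℝ) + 1) ^ 4)
        + (2 / (2 * ((k : ℝ) + 1)) ^ 3) * (1 / (2 * ((k - i : ℕ) : ℝ) + 1) ^ 3)
        + (1 / (2 * ((k : ℝ) + 1)) ^ 4) * (1 / (2 * (i : ℝ) + 1) ^ 2)
        + (3 / (2 * ((k : ℝ) + 1)) ^ 4) * (1 / (2 * ((k - i : ℕ) : ℝ) + 1) ^ 2)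
        + (4 / (2 * ((k : ℝ) + 1)) ^ 5) *
          (1 / (2 * (i : ℝ) + 1) + 1 / (2 * ((k - i : ℕ) : ℝ) + 1)) := by
      intro i hi
      have hk : (k : ℝ) + 1 = ((2 * (i : ℝ) + 1) + (2 * ((k - i : ℕ) : ℝ) + 1)) / 2 := by
        rw [Nat.cast_sub (by simpa [Nat.lt_succ_iff] using hi)]; ring
      rw [hk]
      generalize hp : 2 * (i : ℝ) + 1 = p
      generalize hq : 2 * ((k - i : ℕ) : ℝ) + 1 = q
      have : 0 < p := by rw [← hp]; positivity
      have : 0 < q := by rw [← hq]; positivity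
      field_simp
      ring
    rw [Finset.sum_congr rfl e]
    simp only [Finset.sum_add_distrib, ← Finset.mul_sum]
    rw [r1, r2, r3, r4, h, h2, h3, h4]
    field_simp
    ring
  · norm_num

theorem hasSum_sub_shift {u : ℕ → ℝ} (hu : Antitone u)
    (hl : Filter.Tendsto u Filter.atTop (nhds 0)) (c : ℕ) :
    HasSum (fun d => u d - u (d + c)) (∑ i ∈ range c, u i) := by
  have := hasSum_of_telescope (g := fun D => ∑ i ∈ range c, u (D + i))
    (f := fun d => u d - u (d + c)) (l := 0) ?_ (fun n => sub_nonneg.mpr (hu (by omega))) ?_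
  · simpa using this
  · intro n
    have h1 := Finset.sum_range_succ (fun i => u (n + i)) c
    have h2 := Finset.sum_range_succ' (fun i => u (n + i)) c
    have h3 : ∑ i ∈ range c, u (n + (i + 1)) = ∑ i ∈ range c, u (n + 1 + i) :=
      Finset.sum_congr rfl fun i _ => by congr 1; ring
    simp only [add_zero] at h2
    linarith
  · have : Filter.Tendsto (fun D => ∑ i ∈ range c, u (D + i)) Filter.atTop
        (nhds (∑ i ∈ range c, (0 : ℝ))) :=
      tendsto_finsetSum _ fun i _ => (Filter.tendsto_add_atTop_iff_nat i).mpr hl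
    simpa using this

theorem antitone_one_div_linear {a b : ℝ} (ha : 0 ≤ a) (hb : 0 < b) :
    Antitone fun n : ℕ => 1 / (a * (n : ℝ) + b) := by
  intro m n hmn
  apply one_div_le_one_div_of_le (by positivity)
  have : (m : ℝ) ≤ n := by exact_mod_cast hmn
  gcongr

theorem tendsto_one_div_linear {a : ℝ} (ha : 0 < a) (b : ℝ) :
    Filter.Tendsto (fun n : ℕ => 1 / (a * (n : ℝ) + b)) Filter.atTop (nhds 0) := by
  simp only [one_div]
  apply Filter.Tendsto.inv_tendsto_atTop
  exact Filter.tendsto_atTop_add_const_right _ _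
    (Filter.Tendsto.const_mul_atTop ha tendsto_natCast_atTop_atTop)

theorem hasSum_inv_mul_shift (c : ℕ) :
    HasSum (fun d : ℕ => (1 : ℝ) / (((d : ℝ) + 1) * ((d : ℝ) + 1 + (c + 1)))) (H (c + 1) / (c + 1)) := by
  have := (hasSum_sub_shift (antitone_one_div_linear zero_le_one one_pos)
    (tendsto_one_div_linear one_pos 1) (c + 1)).mul_right (1 / ((c : ℝ) + 1))
  refine this.of_eq (fun d => ?_) ?_
  · push_cast
    field_simp
    ring
  · simp [H, div_eq_mul_inv]

theorem hasSum_odd_inv_mul_shift (c : ℕ) :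
    HasSum (fun d : ℕ => (1 : ℝ) / ((2 * (d : ℝ) + 1) * (2 * (d : ℝ) + 1 + 2 * (c + 1))))
      (h (c + 1) / (2 * (c + 1))) := by
  have := (hasSum_sub_shift (antitone_one_div_linear zero_le_two one_pos)
    (tendsto_one_div_linear two_pos 1) (c + 1)).mul_right (1 / (2 * ((c : ℝ) + 1)))
  refine this.of_eq (fun d => ?_) ?_
  · push_cast
    field_simp
    ring
  · simp [h, div_eq_mul_inv]

theorem hasSum_H_telescoping :
    HasSum (fun n : ℕ => H n / (n * ((n : ℝ) + 1))) (zeta 2) := by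
  have := hasSum_triangle (f := fun m n : ℕ => 1 / (((m : ℝ) + 1) * (n * ((n : ℝ) + 1))))
    (r := fun m => 1 / ((m : ℝ) + 1) ^ 2) (fun _ _ _ => by positivity) ?_ (hasSum_zeta le_rfl)
  · convert this using 2 with n
    rw [H, Finset.sum_div]
    exact Finset.sum_congr rfl fun i _ => by rw [div_div]
  · intro m
    have := (hasSum_sub_shift (u := fun d => 1 / (1 * (d : ℝ) + (m + 1)))
      (antitone_one_div_linear zero_le_one (by positivity))
      (tendsto_one_div_linear one_pos _) 1).mul_left (1 / ((m : ℝ) + 1))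
    refine this.of_eq (fun d => ?_) ?_
    · push_cast
      field_simp
      ring
    · simp
      field_simp

theorem summable_H_div_sq : Summable fun n : ℕ => H n / ((n : ℝ) + 1) ^ 2 := by
  refine Summable.of_nonneg_of_le (fun n => div_nonneg (H_nonneg n) (by positivity)) (fun n => ?_)
    hasSum_H_telescoping.summable
  rcases Nat.eq_zero_or_pos n with rfl | hn
  · simp
  · have : (0 : ℝ) < n := by exact_mod_cast hn
    apply div_le_div_of_nonneg_left (H_nonneg n) (by positivity)
    nlinarith

/-- The Euler identity for `ζ(2, 1)`. -/
theorem hasSum_H_div_sq : HasSum (fun n : ℕ => H n / ((n : ℝ) + 1) ^ 2) (zeta 3) := by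
  have hs := summable_H_div_sq.hasSum
  set S := ∑' n : ℕ, H n / ((n : ℝ) + 1) ^ 2
  have hrow : HasSum (fun n : ℕ => H (n + 1) / ((n : ℝ) + 1) ^ 2) (S + zeta 3) := by
    convert hs.add (hasSum_zeta (s := 3) (by norm_num)) using 2 with n
    rw [H_succ]
    field_simp
  have := hasSum_triangle
    (f := fun m n : ℕ => 1 / (((m : ℝ) + 1) * ((n : ℝ) - m) * ((n : ℝ) + 1)))
    (r := fun m => H (m + 1) / ((m : ℝ) + 1) ^ 2) ?_ ?_ hrow
  · have h2 : HasSum (fun n : ℕ => 2 * (H n / ((n : ℝ) + 1) ^ 2)) (S + zeta 3) := by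
      convert this using 2 with n
      have e : ∀ m ∈ range n, 1 / (((m : ℝ) + 1) * ((n : ℝ) - m) * ((n : ℝ) + 1))
          = (1 / ((n : ℝ) + 1) ^ 2) * (1 / ((m : ℝ) + 1) + 1 / (((n - 1 - m : ℕ) : ℝ) + 1)) := by
        intro m hm
        have hm' := Finset.mem_range.mp hm
        have : (n : ℝ) = m + 1 + (n - 1 - m : ℕ) := by
          rw [Nat.cast_sub (by omega), Nat.cast_sub (by omega)]; push_cast; ring
        rw [this]
        have hq : (m : ℝ) + 1 + (n - 1 - m : ℕ) - m = (n - 1 - m : ℕ) + 1 := by ring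
        rw [hq]
        field_simp
        ring
      rw [Finset.sum_congr rfl e, ← Finset.mul_sum, Finset.sum_add_distrib,
        Finset.sum_range_reflect (fun i : ℕ => 1 / ((i : ℝ) + 1)) n, H]
      ring
    have := h2.unique (hs.mul_left 2)
    have : S = zeta 3 := by linarith
    rwa [this] at hs
  · intro m n hmn
    have : (m : ℝ) < n := by exact_mod_cast hmn
    have : (0 : ℝ) < n - m := by linarith
    positivity
  · intro m
    refine ((hasSum_inv_mul_shift m).mul_left (1 / ((m : ℝ) + 1))).of_eq (fun d => ?_) ?_
    · push_cast
      have : (m : ℝ) + 1 + d - m = d + 1 := by ring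
      rw [this]
      field_simp
      ring
    · field_simp

theorem h_le_H (k : ℕ) : h k ≤ H k := by
  refine Finset.sum_le_sum fun j _ => ?_
  apply one_div_le_one_div_of_le (by positivity)
  linarith [(by positivity : (0 : ℝ) ≤ j)]

theorem H_two_mul (k : ℕ) : H (2 * k) = h k + H k / 2 := by
  induction k with
  | zero => simp
  | succ k ih =>
    rw [show 2 * (k + 1) = 2 * k + 1 + 1 by ring, H_succ, H_succ, ih, h_succ, H_succ]
    push_cast
    field_simp
    ring

theorem hasSum_h_div_sq :
    HasSum (fun k : ℕ => h (k + 1) / ((k : ℝ) + 1) ^ 2) (7 / 4 * zeta 3) := by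
  have hsum : Summable (fun k : ℕ => h (k + 1) / ((k : ℝ) + 1) ^ 2) := by
    refine Summable.of_nonneg_of_le (fun n => div_nonneg (h_nonneg _) (by positivity)) (fun n => ?_)
      (summable_H_div_sq.add (hasSum_zeta (s := 3) (by norm_num)).summable)
    have : H n / ((n : ℝ) + 1) ^ 2 + 1 / ((n : ℝ) + 1) ^ 3 = H (n + 1) / ((n : ℝ) + 1) ^ 2 := by
      rw [H_succ]; field_simp
    rw [this]
    gcongr
    exact h_le_H _
  have hs := hsum.hasSum
  set T := ∑' k : ℕ, h (k + 1) / ((k : ℝ) + 1) ^ 2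
  have hrow : ∀ i : ℕ, Summable fun k : ℕ =>
      1 / ((2 * (i : ℝ) + 1) * (2 * ((k : ℝ) + 1)) * (2 * (i : ℝ) + 1 + 2 * (k + 1))) := by
    intro i
    refine Summable.of_nonneg_of_le (fun k => by positivity) (fun k => ?_)
      (hasSum_zeta (s := 2) (by norm_num)).summable
    apply one_div_le_one_div_of_le (by positivity)
    have hi : (0 : ℝ) ≤ i := by positivity
    have hk : (0 : ℝ) ≤ k := by positivity
    calc ((k : ℝ) + 1) ^ 2 = 1 * (k + 1) * (k + 1) := by ring
      _ ≤ (2 * (i : ℝ) + 1) * (2 * ((k : ℝ) + 1)) * (2 * (i : ℝ) + 1 + 2 * (k + 1)) := by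
        apply mul_le_mul <;> first | positivity | nlinarith
  have h1 := hasSum_swap_of_nonneg
    (f := fun k i : ℕ =>
      1 / ((2 * (i : ℝ) + 1) * (2 * ((k : ℝ) + 1)) * (2 * (i : ℝ) + 1 + 2 * (k + 1))))
    (r := fun k : ℕ => 1 / 4 * (h (k + 1) / ((k : ℝ) + 1) ^ 2)) (fun k i => by positivity)
    (fun k => by
      refine ((hasSum_odd_inv_mul_shift k).mul_left (1 / (2 * ((k : ℝ) + 1)))).of_eq
        (fun d => ?_) ?_
      · field_simp
      · field_simp
        ring)
    (fun i => (hrow i).hasSum) (hs.mul_left (1 / 4))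
  have h2 := hasSum_triangle
    (f := fun i n : ℕ => 1 / ((2 * (i : ℝ) + 1) * (2 * ((n : ℝ) - i)) * (2 * (n : ℝ) + 1)))
    ?_ ?_ h1
  · have he : HasSum (fun n : ℕ => H (2 * n) / (((2 * n : ℕ) : ℝ) + 1) ^ 2) (1 / 4 * T) := by
      convert h2 using 2 with n
      have e : ∀ m ∈ range n, 1 / ((2 * (m : ℝ) + 1) * (2 * ((n : ℝ) - m)) * (2 * (n : ℝ) + 1))
          = (1 / (2 * (n : ℝ) + 1) ^ 2) *
            (1 / (2 * (m : ℝ) + 1) + 1 / 2 * (1 / (((n - 1 - m : ℕ) : ℝ) + 1))) := by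
        intro m hm
        have hm' := Finset.mem_range.mp hm
        have : (n : ℝ) = m + 1 + (n - 1 - m : ℕ) := by
          rw [Nat.cast_sub (by omega), Nat.cast_sub (by omega)]; push_cast; ring
        rw [this]
        have hq : (m : ℝ) + 1 + (n - 1 - m : ℕ) - m = (n - 1 - m : ℕ) + 1 := by ring
        rw [hq]
        field_simp
        ring
      rw [Finset.sum_congr rfl e, ← Finset.mul_sum, Finset.sum_add_distrib, ← Finset.mul_sum,
        Finset.sum_range_reflect (fun i : ℕ => 1 / ((i : ℝ) + 1)) n, H_two_mul]
      simp only [H, h]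
      push_cast
      ring
    have ho : HasSum (fun n : ℕ => H (2 * n + 1) / (((2 * n + 1 : ℕ) : ℝ) + 1) ^ 2)
        (1 / 4 * T + 1 / 8 * zeta 3) := by
      refine ((hs.mul_left (1 / 4)).add (hasSum_H_div_sq.mul_left (1 / 8))).of_eq (fun n => ?_) rfl
      rw [H_succ, H_two_mul, h_succ]
      push_cast
      field_simp
      ring
    have := (HasSum.even_add_odd (f := fun n : ℕ => H n / ((n : ℝ) + 1) ^ 2) he ho).unique
      hasSum_H_div_sq
    have e : T = 7 / 4 * zeta 3 := by linarith
    rwa [e] at hs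
  · intro m n hmn
    have : (m : ℝ) < n := by exact_mod_cast hmn
    have : (0 : ℝ) < n - m := by linarith
    positivity
  · intro m
    refine (hrow m).hasSum.of_eq (fun d => ?_) rfl
    push_cast
    have : (m : ℝ) + 1 + d - m = d + 1 := by ring
    rw [this]
    congr 2
    ring

/-- The product of the first `n` odd numbers. -/
noncomputable def oddProd (n : ℕ) : ℝ := ∏ i ∈ range n, (2 * (i : ℝ) + 1)

@[simp] theorem oddProd_zero : oddProd 0 = 1 := Finset.prod_range_zero _

theorem oddProd_succ (n : ℕ) : oddProd (n + 1) = oddProd n * (2 * (n : ℝ) + 1) :=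
  Finset.prod_range_succ _ _

theorem oddProd_pos (n : ℕ) : 0 < oddProd n := Finset.prod_pos fun _ _ => by positivity

noncomputable def oddBinom (m k : ℕ) : ℝ := oddProd m * oddProd k / oddProd (m + k)

noncomputable def oddKer (m k : ℕ) : ℝ := 2 * oddProd m * oddProd k / oddProd (m + k + 1)

theorem oddBinom_pos (m k : ℕ) : 0 < oddBinom m k :=
  div_pos (mul_pos (oddProd_pos _) (oddProd_pos _)) (oddProd_pos _)

theorem oddKer_pos (m k : ℕ) : 0 < oddKer m k :=
  div_pos (mul_pos (mul_pos two_pos (oddProd_pos _)) (oddProd_pos _)) (oddProd_pos _)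

theorem oddKer_comm (m k : ℕ) : oddKer m k = oddKer k m := by
  rw [oddKer, oddKer, add_comm m k]; ring

theorem oddBinom_zero_left (k : ℕ) : oddBinom 0 k = 1 := by
  simp [oddBinom, (oddProd_pos k).ne']

theorem oddKer_eq (m k : ℕ) : oddKer m k = 2 * oddBinom m k / (2 * ((m : ℝ) + k) + 1) := by
  have := oddProd_pos (m + k)
  rw [oddKer, oddBinom, oddProd_succ]
  push_cast
  field_simp

theorem oddBinom_succ_left (m k : ℕ) :
    oddBinom (m + 1) k = oddBinom m k * (2 * (m : ℝ) + 1) / (2 * ((m : ℝ) + k) + 1) := by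
  have := oddProd_pos (m + k)
  rw [oddBinom, oddBinom, show m + 1 + k = m + k + 1 by ring, oddProd_succ, oddProd_succ]
  push_cast
  field_simp

theorem oddBinom_succ_left' (m k : ℕ) :
    oddBinom (m + 1) k = oddKer m k * (2 * (m : ℝ) + 1) / 2 := by
  rw [oddBinom_succ_left, oddKer_eq]
  field_simp

theorem oddKer_telescope (m k : ℕ) :
    oddKer m (k + 1) = oddBinom m (k + 1) / ((k : ℝ) + 1) - oddBinom (m + 1) (k + 1) / ((k : ℝ) + 1) := by
  rw [oddKer_eq, oddBinom_succ_left]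
  push_cast
  field_simp
  ring

theorem oddBinom_succ_right_le (m k : ℕ) : oddBinom m (k + 1) ≤ 1 / (2 * (m : ℝ) + 1) := by
  induction k with
  | zero =>
    have := oddProd_pos m
    rw [oddBinom, zero_add, oddProd_succ, oddProd_succ, oddProd_zero]
    apply le_of_eq
    field_simp
    simp
  | succ k ih =>
    refine le_trans ?_ ih
    have h1 := oddProd_pos m
    have h2 := oddProd_pos (k + 1)
    have h3 := oddProd_pos (m + (k + 1))
    have : oddBinom m (k + 1 + 1) = oddBinom m (k + 1) *
        ((2 * ((k : ℝ) + 1) + 1) / (2 * ((m : ℝ) + (k + 1)) + 1)) := by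
      rw [oddBinom, oddBinom, show m + (k + 1 + 1) = m + (k + 1) + 1 by ring,
        oddProd_succ (k + 1), oddProd_succ (m + (k + 1))]
      push_cast
      field_simp
    rw [this]
    apply mul_le_of_le_one_right (oddBinom_pos _ _).le
    rw [div_le_one (by positivity)]
    have : (0 : ℝ) ≤ m := by positivity
    linarith

theorem tendsto_oddBinom (k : ℕ) :
    Filter.Tendsto (fun m => oddBinom m (k + 1)) Filter.atTop (nhds 0) := by
  refine squeeze_zero (fun m => (oddBinom_pos _ _).le) (fun m => oddBinom_succ_right_le m k) ?_
  simp only [one_div]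
  apply Filter.Tendsto.inv_tendsto_atTop
  exact Filter.tendsto_atTop_add_const_right _ _
    (Filter.Tendsto.const_mul_atTop two_pos tendsto_natCast_atTop_atTop)

theorem hasSum_oddKer_tail (M k : ℕ) :
    HasSum (fun d => oddKer (M + d) (k + 1)) (oddBinom M (k + 1) / ((k : ℝ) + 1)) := by
  have ht : Filter.Tendsto (fun d => oddBinom (M + d) (k + 1) / ((k : ℝ) + 1)) Filter.atTop
      (nhds 0) := by
    have := ((Filter.tendsto_add_atTop_iff_nat M).mpr (tendsto_oddBinom k)).div_const ((k : ℝ) + 1)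
    simpa [add_comm] using this
  simpa using hasSum_of_telescope (fun d => oddKer_telescope (M + d) k)
    (fun d => (oddKer_pos _ _).le) ht

/-- Elementary symmetric functions of `2 / (2 m + 1)`, `m < n`. -/
noncomputable def oddElem : ℕ → ℕ → ℝ
  | 0, _ => 1
  | i + 1, n => ∑ m ∈ range n, oddElem i m * (2 / (2 * (m : ℝ) + 1))

theorem oddElem_succ_zero (i : ℕ) : oddElem (i + 1) 0 = 0 := by simp [oddElem]

theorem oddElem_succ_succ (i n : ℕ) :
    oddElem (i + 1) (n + 1) = oddElem (i + 1) n + oddElem i n * (2 / (2 * (n : ℝ) + 1)) := by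
  simp only [oddElem]
  exact Finset.sum_range_succ _ _

theorem oddElem_nonneg (i n : ℕ) : 0 ≤ oddElem i n := by
  induction i generalizing n with
  | zero => simp [oddElem]
  | succ i ih => exact Finset.sum_nonneg fun m _ => mul_nonneg (ih m) (by positivity)

theorem hasSum_mul_sum_range {u w W : ℕ → ℝ} {s : ℝ} (hu : ∀ m, 0 ≤ u m)
    (hw : ∀ n, 1 ≤ n → 0 ≤ w n) (hW : ∀ m, HasSum (fun d => w (m + 1 + d)) (W m))
    (hs : HasSum (fun m => u m * W m) s) : HasSum (fun n => w n * ∑ m ∈ range n, u m) s := by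
  refine (hasSum_triangle (f := fun m n => u m * w n) (fun m n hmn =>
    mul_nonneg (hu m) (hw n (by omega))) (fun m => (hW m).mul_left (u m)) hs).of_eq
    (fun n => ?_) rfl
  rw [Finset.mul_sum]
  exact Finset.sum_congr rfl fun _ _ => mul_comm _ _

theorem hasSum_oddKer_mul_oddElem (i k : ℕ) :
    HasSum (fun m => oddKer m (k + 1) * oddElem i m) (1 / ((k : ℝ) + 1) ^ (i + 1)) := by
  induction i with
  | zero =>
    refine (hasSum_oddKer_tail 0 k).of_eq (fun m => ?_) ?_
    · simp [oddElem]
    · simp [oddBinom_zero_left]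
  | succ i ih =>
    refine hasSum_mul_sum_range (w := fun m => oddKer m (k + 1))
      (fun m => mul_nonneg (oddElem_nonneg i m) (by positivity))
      (fun n _ => (oddKer_pos _ _).le) (fun m => hasSum_oddKer_tail (m + 1) k) ?_
    refine (ih.mul_right (1 / ((k : ℝ) + 1))).of_eq (fun m => ?_) ?_
    · rw [oddBinom_succ_left']
      field_simp
    · rw [pow_succ _ (i + 1)]
      field_simp

theorem hasSum_oddElem_duality (i j : ℕ) {s : ℝ}
    (hs : HasSum (fun k : ℕ => oddElem (j + 1) (k + 1) / ((k : ℝ) + 1) ^ (i + 2)) s) :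
    HasSum (fun k : ℕ => oddElem (i + 1) (k + 1) / ((k : ℝ) + 1) ^ (j + 2)) s := by
  refine hasSum_swap_of_nonneg
    (f := fun k m => oddKer (m + 1) (k + 1) * oddElem (i + 1) (m + 1) * oddElem (j + 1) (k + 1))
    (fun k m => mul_nonneg (mul_nonneg (oddKer_pos _ _).le (oddElem_nonneg _ _))
      (oddElem_nonneg _ _)) (fun k => ?_) (fun m => ?_) hs
  · have := (hasSum_nat_add_iff' 1).mpr (hasSum_oddKer_mul_oddElem (i + 1) k)
    simp only [Finset.sum_range_one, oddElem_succ_zero, mul_zero, sub_zero] at this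
    exact (this.mul_right (oddElem (j + 1) (k + 1))).of_eq (fun _ => rfl) (by ring)
  · have := (hasSum_nat_add_iff' 1).mpr (hasSum_oddKer_mul_oddElem (j + 1) m)
    simp only [Finset.sum_range_one, oddElem_succ_zero, mul_zero, sub_zero] at this
    refine (this.mul_right (oddElem (i + 1) (m + 1))).of_eq (fun k => ?_) (by ring)
    rw [oddKer_comm]
    ring

theorem oddElem_one (n : ℕ) : oddElem 1 n = 2 * h n := by
  induction n with
  | zero => simp [oddElem_succ_zero]
  | succ n ih => rw [oddElem_succ_succ, ih, h_succ, oddElem]; ring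

theorem oddElem_two (n : ℕ) : oddElem 2 n = 2 * (h n ^ 2 - h2 n) := by
  induction n with
  | zero => simp [oddElem_succ_zero]
  | succ n ih => rw [oddElem_succ_succ, ih, oddElem_one, h_succ, h2_succ]; field_simp; ring

theorem oddElem_three (n : ℕ) :
    oddElem 3 n = 4 / 3 * (h n ^ 3 - 3 * h n * h2 n + 2 * h3 n) := by
  induction n with
  | zero => simp [oddElem_succ_zero]
  | succ n ih =>
    rw [oddElem_succ_succ, ih, oddElem_two, h_succ, h2_succ, h3_succ]; field_simp; ring

theorem h_add_le (m k : ℕ) : h (m + k) ≤ h m + h k := by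
  induction k with
  | zero => simp
  | succ k ih =>
    rw [← add_assoc, h_succ, h_succ]
    have : 1 / (2 * ((m + k : ℕ) : ℝ) + 1) ≤ 1 / (2 * (k : ℝ) + 1) := by
      apply one_div_le_one_div_of_le (by positivity)
      push_cast
      linarith [(by positivity : (0 : ℝ) ≤ m)]
    linarith

theorem h_add_succ_le (m k : ℕ) : h (m + 1 + (k + 1) + 1) ≤ h (m + 1) + h (k + 1) := by
  induction k with
  | zero =>
    have h1 : 1 / (2 * ((m + 1 : ℕ) : ℝ) + 1) ≤ 1 / 3 := by
      apply one_div_le_one_div_of_le (by positivity)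
      push_cast
      linarith [(by positivity : (0 : ℝ) ≤ m)]
    have h2 : 1 / (2 * ((m + 1 + 1 : ℕ) : ℝ) + 1) ≤ 1 / 3 := by
      apply one_div_le_one_div_of_le (by positivity)
      push_cast
      linarith [(by positivity : (0 : ℝ) ≤ m)]
    rw [zero_add, h_succ (m + 1 + 1), h_succ (m + 1), h_succ 0, h_zero]
    norm_num at *
    linarith
  | succ k ih =>
    have : 1 / (2 * ((m + 1 + (k + 1) + 1 : ℕ) : ℝ) + 1) ≤ 1 / (2 * ((k + 1 : ℕ) : ℝ) + 1) := by
      apply one_div_le_one_div_of_le (by positivity)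
      push_cast
      linarith [(by positivity : (0 : ℝ) ≤ m)]
    rw [show m + 1 + (k + 1 + 1) + 1 = m + 1 + (k + 1) + 1 + 1 by ring, h_succ (m + 1 + (k + 1) + 1),
      h_succ (k + 1)]
    linarith

noncomputable def oddKerDeriv (m k : ℕ) : ℝ := oddKer m k * (2 * (h m + h k - h (m + k + 1)))

noncomputable def oddBinomDeriv (m k : ℕ) : ℝ := oddBinom m k * (2 * (h m + h k - h (m + k)))

theorem oddKerDeriv_comm (m k : ℕ) : oddKerDeriv m k = oddKerDeriv k m := by
  rw [oddKerDeriv, oddKerDeriv, oddKer_comm, add_comm (h m), add_comm m k]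

theorem oddKerDeriv_nonneg (m k : ℕ) : 0 ≤ oddKerDeriv (m + 1) (k + 1) :=
  mul_nonneg (oddKer_pos _ _).le (by linarith [h_add_succ_le m k])

theorem oddKerDeriv_telescope (m k : ℕ) :
    oddKerDeriv m (k + 1) = oddBinomDeriv m (k + 1) / ((k : ℝ) + 1)
      - oddBinomDeriv (m + 1) (k + 1) / ((k : ℝ) + 1) := by
  rw [oddKerDeriv, oddBinomDeriv, oddBinomDeriv, show m + 1 + (k + 1) = m + (k + 1) + 1 by ring,
    h_succ (m + (k + 1)), h_succ m, oddKer_eq, oddBinom_succ_left]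
  push_cast
  field_simp
  ring

theorem oddBinomDeriv_succ_left (m k : ℕ) :
    oddBinomDeriv (m + 1) k * (2 / (2 * (m : ℝ) + 1))
      = oddKerDeriv m k + oddKer m k * (2 / (2 * (m : ℝ) + 1)) := by
  rw [oddBinomDeriv, oddKerDeriv, oddBinom_succ_left', h_succ, show m + 1 + k = m + k + 1 by ring]
  field_simp
  ring

theorem tendsto_oddBinomDeriv (k : ℕ) :
    Filter.Tendsto (fun m => oddBinomDeriv m (k + 1)) Filter.atTop (nhds 0) := by
  have hb := (tendsto_oddBinom k).mul_const (2 * h (k + 1))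
  rw [zero_mul] at hb
  refine squeeze_zero (fun m => ?_) (fun m => ?_) hb
  · exact mul_nonneg (oddBinom_pos _ _).le (by linarith [h_add_le m (k + 1)])
  · apply mul_le_mul_of_nonneg_left _ (oddBinom_pos _ _).le
    have : h m ≤ h (m + (k + 1)) :=
      Finset.sum_le_sum_of_subset_of_nonneg (Finset.range_mono (by omega))
        (fun _ _ _ => by positivity)
    linarith

theorem hasSum_oddKerDeriv_tail (M k : ℕ) :
    HasSum (fun d => oddKerDeriv (M + 1 + d) (k + 1))
      (oddBinomDeriv (M + 1) (k + 1) / ((k : ℝ) + 1)) := by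
  have ht : Filter.Tendsto (fun d => oddBinomDeriv (M + 1 + d) (k + 1) / ((k : ℝ) + 1)) Filter.atTop
      (nhds 0) := by
    have := ((Filter.tendsto_add_atTop_iff_nat (M + 1)).mpr (tendsto_oddBinomDeriv k)).div_const
      ((k : ℝ) + 1)
    simpa [add_comm, add_left_comm] using this
  simpa using hasSum_of_telescope (fun d => oddKerDeriv_telescope (M + 1 + d) k)
    (fun d => by rw [show M + 1 + d = M + d + 1 by ring]; exact oddKerDeriv_nonneg _ _) ht

/-- Negative of the derivative of `oddElem` with respect to a common shift of the nodes. -/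
noncomputable def oddElemDeriv : ℕ → ℕ → ℝ
  | 0, _ => 0
  | i + 1, n => ∑ m ∈ range n, (oddElemDeriv i m + oddElem i m * (2 / (2 * (m : ℝ) + 1)))
      * (2 / (2 * (m : ℝ) + 1))

theorem oddElemDeriv_succ_zero (i : ℕ) : oddElemDeriv (i + 1) 0 = 0 := by simp [oddElemDeriv]

theorem oddElemDeriv_succ_succ (i n : ℕ) :
    oddElemDeriv (i + 1) (n + 1) = oddElemDeriv (i + 1) n
      + (oddElemDeriv i n + oddElem i n * (2 / (2 * (n : ℝ) + 1))) * (2 / (2 * (n : ℝ) + 1)) := by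
  simp only [oddElemDeriv]
  exact Finset.sum_range_succ _ _

theorem oddElemDeriv_nonneg (i n : ℕ) : 0 ≤ oddElemDeriv i n := by
  induction i generalizing n with
  | zero => simp [oddElemDeriv]
  | succ i ih =>
    exact Finset.sum_nonneg fun m _ => mul_nonneg (add_nonneg (ih m)
      (mul_nonneg (oddElem_nonneg i m) (by positivity))) (by positivity)

theorem exists_hasSum_oddKerDeriv (i k : ℕ) :
    ∃ x, HasSum (fun m => oddKerDeriv m (k + 1) * oddElem i m) x ∧
      HasSum (fun m => oddKer m (k + 1) * oddElemDeriv i m) x := by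
  induction i with
  | zero =>
    refine ⟨0, ?_, by simp [oddElemDeriv]⟩
    simp only [oddElem, mul_one]
    rw [← hasSum_nat_add_iff' 1]
    refine (hasSum_oddKerDeriv_tail 0 k).of_eq (fun m => by rw [zero_add, add_comm]) ?_
    have := oddKerDeriv_telescope 0 k
    rw [oddBinomDeriv] at this
    simp at this
    simp [this]
  | succ i ih =>
    obtain ⟨x, hx, hx'⟩ := ih
    have hy : Summable fun m => oddKer m (k + 1) * oddElem i m * (2 / (2 * (m : ℝ) + 1)) := by
      refine Summable.of_nonneg_of_le (fun m => mul_nonneg (mul_nonneg (oddKer_pos _ _).le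
        (oddElem_nonneg _ _)) (by positivity)) (fun m => ?_)
        ((hasSum_oddKer_mul_oddElem i k).summable.mul_right 2)
      apply mul_le_mul_of_nonneg_left _ (mul_nonneg (oddKer_pos _ _).le (oddElem_nonneg _ _))
      rw [div_le_iff₀ (by positivity)]
      linarith [(by positivity : (0 : ℝ) ≤ m)]
    obtain ⟨y, hy⟩ := hy
    refine ⟨(x + y) * (1 / ((k : ℝ) + 1)), ?_, ?_⟩
    · refine hasSum_mul_sum_range (w := fun m => oddKerDeriv m (k + 1))
        (fun m => mul_nonneg (oddElem_nonneg i m) (by positivity)) (fun n hn => ?_)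
        (fun m => hasSum_oddKerDeriv_tail m k) ?_
      · obtain ⟨n, rfl⟩ := Nat.exists_eq_add_of_le' hn
        exact oddKerDeriv_nonneg _ _
      · refine ((hx.add hy).mul_right (1 / ((k : ℝ) + 1))).of_eq (fun m => ?_) rfl
        have := oddBinomDeriv_succ_left m (k + 1)
        linear_combination (oddElem i m * (1 / ((k : ℝ) + 1))) * this
    · refine hasSum_mul_sum_range (w := fun m => oddKer m (k + 1))
        (fun m => mul_nonneg (add_nonneg (oddElemDeriv_nonneg _ _) (mul_nonneg (oddElem_nonneg i m)
          (by positivity))) (by positivity))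
        (fun n _ => (oddKer_pos _ _).le) (fun m => hasSum_oddKer_tail (m + 1) k) ?_
      refine ((hx'.add hy).mul_right (1 / ((k : ℝ) + 1))).of_eq (fun m => ?_) rfl
      rw [oddBinom_succ_left']
      field_simp

theorem hasSum_oddElemDeriv_duality (i j : ℕ) {s : ℝ}
    (hs : HasSum (fun m : ℕ => oddElemDeriv (i + 1) (m + 1) / ((m : ℝ) + 1) ^ (j + 2)) s) :
    HasSum (fun k : ℕ => oddElemDeriv (j + 1) (k + 1) / ((k : ℝ) + 1) ^ (i + 2)) s := by
  have tail : ∀ {f : ℕ → ℝ} {a : ℝ}, HasSum f a → f 0 = 0 → HasSum (fun n => f (n + 1)) a := by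
    intro f a hf h0
    have := (hasSum_nat_add_iff' 1).mpr hf
    simpa [h0] using this
  choose x hx hx' using exists_hasSum_oddKerDeriv
  have e1 : HasSum (fun k : ℕ => x (i + 1) k * oddElem (j + 1) (k + 1)) s := by
    refine hasSum_swap_of_nonneg
      (f := fun m k => oddKer (m + 1) (k + 1) * oddElemDeriv (i + 1) (m + 1)
        * oddElem (j + 1) (k + 1))
      (fun m k => mul_nonneg (mul_nonneg (oddKer_pos _ _).le (oddElemDeriv_nonneg _ _))
        (oddElem_nonneg _ _)) (fun m => ?_) (fun k => ?_) hs
    · have := tail (hasSum_oddKer_mul_oddElem (j + 1) m) (by simp [oddElem_succ_zero])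
      refine (this.mul_right (oddElemDeriv (i + 1) (m + 1))).of_eq (fun k => ?_) (by ring)
      rw [oddKer_comm]
      ring
    · exact (tail (hx' (i + 1) k) (by simp [oddElemDeriv_succ_zero])).mul_right _
  have e2 : HasSum (fun m : ℕ => x (j + 1) m * oddElem (i + 1) (m + 1)) s := by
    refine hasSum_swap_of_nonneg
      (f := fun k m => oddKerDeriv (m + 1) (k + 1) * oddElem (i + 1) (m + 1)
        * oddElem (j + 1) (k + 1))
      (fun m k => mul_nonneg (mul_nonneg (oddKerDeriv_nonneg _ _) (oddElem_nonneg _ _))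
        (oddElem_nonneg _ _)) (fun k => ?_) (fun m => ?_) e1
    · exact (tail (hx (i + 1) k) (by simp [oddElem_succ_zero])).mul_right _
    · refine ((tail (hx (j + 1) m) (by simp [oddElem_succ_zero])).mul_right
        (oddElem (i + 1) (m + 1))).of_eq (fun k => ?_) rfl
      rw [oddKerDeriv_comm]
      ring
  refine hasSum_swap_of_nonneg
    (f := fun m k => oddKer (m + 1) (k + 1) * oddElem (i + 1) (m + 1)
      * oddElemDeriv (j + 1) (k + 1))
    (fun m k => mul_nonneg (mul_nonneg (oddKer_pos _ _).le (oddElem_nonneg _ _))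
      (oddElemDeriv_nonneg _ _)) (fun m => ?_) (fun k => ?_) e2
  · refine ((tail (hx' (j + 1) m) (by simp [oddElemDeriv_succ_zero])).mul_right
      (oddElem (i + 1) (m + 1))).of_eq (fun k => ?_) rfl
    rw [oddKer_comm]
    ring
  · have := tail (hasSum_oddKer_mul_oddElem (i + 1) k) (by simp [oddElem_succ_zero])
    exact (this.mul_right (oddElemDeriv (j + 1) (k + 1))).of_eq (fun _ => rfl) (by ring)

theorem oddElemDeriv_one (n : ℕ) : oddElemDeriv 1 n = 4 * h2 n := by
  induction n with
  | zero => simp [oddElemDeriv_succ_zero]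
  | succ n ih => rw [oddElemDeriv_succ_succ, ih, h2_succ, oddElem, oddElemDeriv]; field_simp; ring

theorem oddElemDeriv_two (n : ℕ) : oddElemDeriv 2 n = 8 * (h n * h2 n - h3 n) := by
  induction n with
  | zero => simp [oddElemDeriv_succ_zero]
  | succ n ih =>
    rw [oddElemDeriv_succ_succ, ih, h_succ, h2_succ, h3_succ, oddElem_one, oddElemDeriv_one]
    field_simp
    ring

theorem oddElemDeriv_three (n : ℕ) :
    oddElemDeriv 3 n = 8 * (h n ^ 2 * h2 n - h2 n ^ 2) - 16 * (h n * h3 n) + 16 * h4 n := by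
  induction n with
  | zero => simp [oddElemDeriv_succ_zero]
  | succ n ih =>
    rw [oddElemDeriv_succ_succ, ih, h_succ, h2_succ, h3_succ, h4_succ, oddElem_two,
      oddElemDeriv_two]
    field_simp
    ring

theorem summable_div_pow_of_le {f : ℕ → ℝ} {C : ℝ} {s : ℕ} (hs : 2 ≤ s) (hf : ∀ n, 0 ≤ f n)
    (hC : ∀ n, f n ≤ C) : Summable fun k : ℕ => f (k + 1) / ((k : ℝ) + 1) ^ s := by
  refine Summable.of_nonneg_of_le (fun n => div_nonneg (hf _) (by positivity)) (fun n => ?_)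
    ((hasSum_zeta hs).summable.mul_left C)
  rw [mul_one_div]
  gcongr
  exact hC _

theorem summable_h_div_pow {s : ℕ} (hs : 3 ≤ s) :
    Summable fun k : ℕ => h (k + 1) / ((k : ℝ) + 1) ^ s := by
  refine Summable.of_nonneg_of_le (fun n => div_nonneg (h_nonneg _) (by positivity)) (fun n => ?_)
    ((hasSum_zeta (s := s - 1) (by omega)).summable)
  have h1 := h_le (n + 1)
  push_cast at h1
  obtain ⟨t, rfl⟩ : ∃ t, s = t + 1 := ⟨s - 1, by omega⟩
  rw [Nat.add_sub_cancel, pow_succ, div_le_div_iff₀ (by positivity) (by positivity)]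
  have : (0 : ℝ) < ((n : ℝ) + 1) ^ t := by positivity
  nlinarith

theorem hasSum_h_sq_div_sq :
    HasSum (fun k : ℕ => h (k + 1) ^ 2 / ((k : ℝ) + 1) ^ 2) (2 * (3 / 4 * zeta 2) ^ 2) := by
  obtain ⟨r, hr⟩ := summable_h_div_pow (s := 3) le_rfl
  have := hasSum_oddElem_duality 1 0 (s := 2 * r)
    ((hr.mul_left 2).of_eq (fun k => by rw [oddElem_one]; ring) rfl)
  refine ((this.mul_left (1 / 2)).add ((hasSum_shuffle_two_two.mul_left 2).sub hr)).of_eq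
    (fun k => ?_) ?_
  · rw [oddElem_two]
    field_simp
    ring
  · ring

noncomputable def zetaTail (s i : ℕ) : ℝ := ∑' d : ℕ, 1 / (((i + 1 + d : ℕ) : ℝ)) ^ s

theorem hasSum_zetaTail {s : ℕ} (hs : 2 ≤ s) (i : ℕ) :
    HasSum (fun d : ℕ => 1 / (((i + 1 + d : ℕ) : ℝ)) ^ s) (zetaTail s i) := by
  apply Summable.hasSum
  have := (summable_nat_add_iff (i + 1)).mpr (Real.summable_one_div_nat_pow (p := s).mpr (by omega))
  simpa [add_comm] using this

theorem zetaTail_zero {s : ℕ} (hs : 2 ≤ s) : zetaTail s 0 = zeta s :=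
  (hasSum_zetaTail hs 0).unique
    ((hasSum_zeta hs).of_eq (fun d => by push_cast; ring_nf) rfl)

theorem zetaTail_succ {s : ℕ} (hs : 2 ≤ s) (i : ℕ) :
    zetaTail s i = 1 / ((i : ℝ) + 1) ^ s + zetaTail s (i + 1) := by
  have := (hasSum_nat_add_iff' 1).mpr (hasSum_zetaTail hs i)
  simp only [Finset.sum_range_one] at this
  have h2 := this.unique ((hasSum_zetaTail hs (i + 1)).of_eq (fun d => by
    rw [show i + 1 + (d + 1) = i + 1 + 1 + d by ring]) rfl)
  push_cast at h2
  simp only [add_zero] at h2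
  linarith

theorem zetaTail_nonneg (s i : ℕ) : 0 ≤ zetaTail s i := tsum_nonneg fun _ => by positivity

theorem zetaTail_le {s : ℕ} (hs : 2 ≤ s) (i : ℕ) : zetaTail s i ≤ zeta s := by
  induction i with
  | zero => rw [zetaTail_zero hs]
  | succ i ih =>
    have := zetaTail_succ hs i
    have : (0 : ℝ) ≤ 1 / ((i : ℝ) + 1) ^ s := by positivity
    linarith

theorem hasSum_inv_mul_shift_sq (c : ℕ) :
    HasSum (fun d : ℕ => (1 : ℝ) / (((d : ℝ) + 1) * ((d : ℝ) + 1 + (c + 1)) ^ 2))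
      (H (c + 1) / ((c : ℝ) + 1) ^ 2 - zetaTail 2 (c + 1) / (c + 1)) := by
  refine (((hasSum_inv_mul_shift c).sub (hasSum_zetaTail le_rfl (c + 1))).mul_right
    (1 / ((c : ℝ) + 1))).of_eq (fun d => ?_) ?_
  · push_cast
    field_simp
    ring
  · field_simp

theorem hasSum_H_div_shift_sq (i : ℕ) :
    HasSum (fun d : ℕ => H d / (((i + 1 + d : ℕ) : ℝ)) ^ 2)
      (zetaTail 3 i + H i * zetaTail 2 i) := by
  induction i with
  | zero =>
    refine hasSum_H_div_sq.of_eq (fun d => ?_) ?_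
    · push_cast
      ring_nf
    · rw [zetaTail_zero (by norm_num)]
      simp
  | succ i ih =>
    have := (hasSum_nat_add_iff' 1).mpr ih
    refine (this.sub (hasSum_inv_mul_shift_sq i)).of_eq (fun d => ?_) ?_
    · rw [H_succ]
      push_cast
      field_simp
      ring
    · rw [zetaTail_succ (s := 3) (by norm_num) i, zetaTail_succ (s := 2) le_rfl i, H_succ]
      simp
      field_simp
      ring

theorem sum_H_sub_H_div (k : ℕ) :
    ∑ i ∈ range k, (H (k - 1 - i) - H i) / (2 * (i : ℝ) + 1) ^ 3
      = h2 k ^ 2 + 2 * h k * h3 k - 3 * h4 k := by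
  induction k with
  | zero => simp
  | succ k ih =>
    have hH : H k = ∑ i ∈ range k, 1 / (((k - 1 - i : ℕ) : ℝ) + 1) :=
      (Finset.sum_range_reflect (fun i : ℕ => 1 / ((i : ℝ) + 1)) k).symm
    have e : ∀ i ∈ range k, (H (k + 1 - 1 - i) - H i) / (2 * (i : ℝ) + 1) ^ 3
        = (H (k - 1 - i) - H i) / (2 * (i : ℝ) + 1) ^ 3
          + (2 / (2 * (k : ℝ) + 1)) * (1 / (2 * (i : ℝ) + 1) ^ 3)
          + (2 / (2 * (k : ℝ) + 1) ^ 2) * (1 / (2 * (i : ℝ) + 1) ^ 2)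
          + (2 / (2 * (k : ℝ) + 1) ^ 3) * (1 / (2 * (i : ℝ) + 1))
          + (1 / (2 * (k : ℝ) + 1) ^ 3) * (1 / (((k - 1 - i : ℕ) : ℝ) + 1)) := by
      intro i hi
      have hi' := Finset.mem_range.mp hi
      have hk : (k : ℝ) = i + 1 + (k - 1 - i : ℕ) := by
        rw [Nat.cast_sub (by omega), Nat.cast_sub (by omega)]; push_cast; ring
      rw [show k + 1 - 1 - i = (k - 1 - i) + 1 by omega, H_succ]
      rw [hk]
      have hq : (0 : ℝ) ≤ ((k - 1 - i : ℕ) : ℝ) := by positivity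
      generalize ((k - 1 - i : ℕ) : ℝ) = q at *
      generalize H (k - 1 - i) = A
      field_simp
      ring
    rw [Finset.sum_range_succ, Finset.sum_congr rfl e]
    simp only [Finset.sum_add_distrib, ← Finset.mul_sum]
    rw [ih, ← hH, h_succ, h2_succ, h3_succ, h4_succ]
    simp only [h, h2, h3, h4]
    simp
    field_simp
    ring

theorem hasSum_h3_tail {v : ℝ}
    (hv : HasSum (fun k : ℕ => h3 (k + 1) / ((k : ℝ) + 1) ^ 3) v) :
    HasSum (fun i : ℕ => zetaTail 3 i / (2 * (i : ℝ) + 1) ^ 3) v := by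
  refine hasSum_triangle_symm
    (f := fun i k : ℕ => 1 / (2 * (i : ℝ) + 1) ^ 3 * (1 / (k : ℝ) ^ 3))
    (fun _ _ _ => by positivity) (fun i => ?_) ?_
  · exact ((hasSum_zetaTail (s := 3) (by norm_num) i).mul_left
      (1 / (2 * (i : ℝ) + 1) ^ 3)).of_eq (fun _ => rfl) (by ring)
  · rw [← hasSum_nat_add_iff' 1]
    refine hv.of_eq (fun k => ?_) (by simp)
    rw [← Finset.sum_mul, h3]
    push_cast
    ring

theorem hasSum_h2_sq_add {v : ℝ}
    (hv : HasSum (fun k : ℕ => h3 (k + 1) / ((k : ℝ) + 1) ^ 3) v) :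
    HasSum (fun k : ℕ => (h2 (k + 1) ^ 2 + 2 * h (k + 1) * h3 (k + 1) - 3 * h4 (k + 1))
      / ((k : ℝ) + 1) ^ 2) v := by
  have hw : Summable fun i : ℕ => H i * zetaTail 2 i / (2 * (i : ℝ) + 1) ^ 3 := by
    refine Summable.of_nonneg_of_le (fun i => div_nonneg (mul_nonneg (H_nonneg i)
      (zetaTail_nonneg _ _)) (by positivity)) (fun i => ?_) (summable_H_div_sq.mul_right (zeta 2))
    rw [div_mul_eq_mul_div]
    apply div_le_div₀ (mul_nonneg (H_nonneg i) ((zetaTail_nonneg 2 i).trans (zetaTail_le le_rfl i)))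
      (mul_le_mul_of_nonneg_left (zetaTail_le le_rfl i) (H_nonneg i)) (by positivity)
    have : (0 : ℝ) ≤ i := by positivity
    nlinarith [mul_nonneg this this, mul_nonneg this (mul_nonneg this this)]
  obtain ⟨w, hw⟩ := hw
  have h1 := hasSum_triangle
    (f := fun i k : ℕ => 1 / (2 * (i : ℝ) + 1) ^ 3 * (H (k - 1 - i) / (k : ℝ) ^ 2))
    (fun _ _ _ => mul_nonneg (by positivity) (div_nonneg (H_nonneg _) (by positivity)))
    (r := fun i => zetaTail 3 i / (2 * (i : ℝ) + 1) ^ 3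
      + H i * zetaTail 2 i / (2 * (i : ℝ) + 1) ^ 3)
    (fun i => ((hasSum_H_div_shift_sq i).mul_left (1 / (2 * (i : ℝ) + 1) ^ 3)).of_eq (fun d => by
      rw [show i + 1 + d - 1 - i = d by omega]) (by ring)) ((hasSum_h3_tail hv).add hw)
  have h2 := hasSum_triangle
    (f := fun i k : ℕ => 1 / (2 * (i : ℝ) + 1) ^ 3 * H i * (1 / (k : ℝ) ^ 2))
    (fun _ _ _ => mul_nonneg (mul_nonneg (by positivity) (H_nonneg _)) (by positivity))
    (r := fun i => H i * zetaTail 2 i / (2 * (i : ℝ) + 1) ^ 3)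
    (fun i => ((hasSum_zetaTail le_rfl i).mul_left (1 / (2 * (i : ℝ) + 1) ^ 3 * H i)).of_eq
      (fun d => rfl) (by ring)) hw
  have h3 := h1.sub h2
  rw [← hasSum_nat_add_iff' 1] at h3
  refine h3.of_eq (fun k => ?_) (by simp)
  rw [← sum_H_sub_H_div, Finset.sum_div, ← Finset.sum_sub_distrib]
  refine Finset.sum_congr rfl fun i _ => ?_
  push_cast
  ring

theorem hasSum_target_of_values {v q x : ℝ}
    (hv : HasSum (fun k : ℕ => h3 (k + 1) / ((k : ℝ) + 1) ^ 3) v)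
    (hq : HasSum (fun k : ℕ => h2 (k + 1) / ((k : ℝ) + 1) ^ 4) q)
    (hx : HasSum (fun k : ℕ => h4 (k + 1) / ((k : ℝ) + 1) ^ 2) x) :
    HasSum (fun k : ℕ => h2 (k + 1) * (h (k + 1)) ^ 2 / ((k : ℝ) + 1) ^ 2) (x + v + q / 2) := by
  have := hasSum_oddElemDeriv_duality 0 2 (s := 4 * q)
    ((hq.mul_left 4).of_eq (fun k => by rw [oddElemDeriv_one]; ring) rfl)
  refine ((this.mul_left (1 / 8)).add ((hasSum_h2_sq_add hv).add hx)).of_eq (fun k => ?_) (by ring)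
  rw [oddElemDeriv_three]
  ring

/-- The even extension of `h` to the integers. -/
noncomputable def hInt (z : ℤ) : ℝ := h z.natAbs

theorem hInt_natCast (n : ℕ) : hInt n = h n := by simp [hInt]

theorem hInt_neg (z : ℤ) : hInt (-z) = hInt z := by simp [hInt]

theorem hInt_add_one (z : ℤ) : hInt (z + 1) = hInt z + 1 / (2 * (z : ℝ) + 1) := by
  obtain ⟨n, rfl | rfl⟩ := z.eq_nat_or_neg
  · rw [← Nat.cast_succ, hInt_natCast, hInt_natCast, Nat.succ_eq_add_one, h_succ]
    simp
  · rcases n with _ | n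
    · simp [hInt, h_succ]
    · have e : -((n + 1 : ℕ) : ℤ) + 1 = -(n : ℤ) := by push_cast; ring
      rw [e, hInt_neg, hInt_neg, hInt_natCast, hInt_natCast, h_succ]
      push_cast
      have h1 : 2 * (-((n : ℝ) + 1)) + 1 = -(2 * (n : ℝ) + 1) := by ring
      rw [h1, div_neg]
      ring

/-- Backward difference of the even extension of `h`. -/
noncomputable def hBack (n d : ℕ) : ℝ := hInt n - hInt (n - d)

theorem hBack_zero_right (n : ℕ) : hBack n 0 = 0 := by simp [hBack]

theorem hBack_succ_right (n d : ℕ) :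
    hBack n (d + 1) = hBack n d + 1 / (2 * ((n : ℝ) - d - 1) + 1) := by
  have := hInt_add_one ((n : ℤ) - (d + 1 : ℕ))
  rw [show (n : ℤ) - (d + 1 : ℕ) + 1 = n - d by push_cast; ring] at this
  rw [hBack, hBack, this]
  push_cast
  ring_nf

theorem hBack_succ_succ (n d : ℕ) :
    hBack (n + 1) (d + 1) = hBack n d + 1 / (2 * (n : ℝ) + 1) := by
  have := hInt_add_one n
  rw [hBack, hBack, show ((n + 1 : ℕ) : ℤ) - (d + 1 : ℕ) = n - d by push_cast; ring]
  push_cast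
  rw [this]
  push_cast
  ring

theorem hBack_add_two_mul (n d : ℕ) : hBack n (2 * n + d) = h n - h (n + d) := by
  rw [hBack, hInt_natCast, show (n : ℤ) - (2 * n + d : ℕ) = -((n + d : ℕ) : ℤ) by push_cast; ring,
    hInt_neg, hInt_natCast]

theorem hBack_sub {n k : ℕ} (hk : k ≤ n) : hBack n (n - k) = h n - h k := by
  rw [hBack, hInt_natCast, show (n : ℤ) - (n - k : ℕ) = (k : ℤ) by
    rw [Nat.cast_sub hk]; ring, hInt_natCast]

theorem hBack_add (n k : ℕ) : hBack n (n + k) = h n - h k := by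
  rw [hBack, hInt_natCast, show (n : ℤ) - (n + k : ℕ) = -(k : ℤ) by push_cast; ring,
    hInt_neg, hInt_natCast]

theorem odd_sub_ne_zero (n d : ℕ) : 2 * ((n : ℝ) - d - 1) + 1 ≠ 0 := by
  intro h0
  have : (2 * ((n : ℤ) - d - 1) + 1 : ℤ) = 0 := by exact_mod_cast h0
  omega

theorem hBack_succ_succ_sub (n d : ℕ) :
    hBack (n + 1) (d + 1) - hBack n (d + 1)
      = -(2 * ((d : ℝ) + 1) / (2 * (n : ℝ) + 1)) * (hBack n (d + 1) - hBack n d) := by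
  rw [hBack_succ_succ, hBack_succ_right]
  have h0 := odd_sub_ne_zero n d
  have h1 : 2 * (n : ℝ) + 1 ≠ 0 := by positivity
  field_simp
  ring

theorem sum_hBack_succ_sub (n D : ℕ) :
    ∑ d ∈ range D, hBack (n + 1) (d + 1) / ((d : ℝ) + 1)
      - ∑ d ∈ range D, hBack n (d + 1) / ((d : ℝ) + 1) = -(2 / (2 * (n : ℝ) + 1)) * hBack n D := by
  induction D with
  | zero => simp [hBack_zero_right]
  | succ D ih =>
    rw [Finset.sum_range_succ, Finset.sum_range_succ]
    have h1 := hBack_succ_succ_sub n D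
    have h2 : hBack (n + 1) (D + 1) / ((D : ℝ) + 1) - hBack n (D + 1) / ((D : ℝ) + 1)
        = -(2 / (2 * (n : ℝ) + 1)) * (hBack n (D + 1) - hBack n D) := by
      rw [← sub_div, h1]
      field_simp
    linarith

theorem sum_hBack_sq_succ_sub (n D : ℕ) :
    ∑ d ∈ range D, hBack (n + 1) (d + 1) ^ 2 / ((d : ℝ) + 1)
      - ∑ d ∈ range D, hBack n (d + 1) ^ 2 / ((d : ℝ) + 1)
      = -(2 / (2 * (n : ℝ) + 1)) * (hBack n D * (hBack n D + 1 / (2 * (n : ℝ) + 1))) := by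
  induction D with
  | zero => simp [hBack_zero_right]
  | succ D ih =>
    rw [Finset.sum_range_succ, Finset.sum_range_succ]
    have h1 := hBack_succ_succ_sub n D
    have h2 : hBack (n + 1) (D + 1) ^ 2 / ((D : ℝ) + 1) - hBack n (D + 1) ^ 2 / ((D : ℝ) + 1)
        = -(2 / (2 * (n : ℝ) + 1)) * (hBack n (D + 1) - hBack n D)
          * (hBack n (D + 1) + hBack n D + 1 / (2 * (n : ℝ) + 1)) := by
      rw [← sub_div, sq_sub_sq, h1, hBack_succ_succ]
      field_simp
      ring
    linear_combination ih + h2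

theorem sum_hBack_two_mul (n : ℕ) :
    ∑ d ∈ range (2 * n), hBack n (d + 1) / ((d : ℝ) + 1) = h2 n := by
  induction n with
  | zero => simp
  | succ n ih =>
    have h1 := sum_hBack_succ_sub n (2 * n + 1)
    rw [Finset.sum_range_succ (fun d : ℕ => hBack n (d + 1) / ((d : ℝ) + 1)), ih,
      hBack_add_two_mul, h_succ] at h1
    have h0 := hBack_add_two_mul (n + 1) 0
    rw [show 2 * (n + 1) = 2 * n + 1 + 1 by ring, Finset.sum_range_succ, h2_succ]
    rw [show 2 * (n + 1) + 0 = 2 * n + 1 + 1 by ring] at h0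
    rw [h0]
    push_cast at h1 ⊢
    simp only [add_zero, sub_self, zero_div]
    field_simp at h1 ⊢
    linear_combination h1

theorem sum_hBack_sq_two_mul (n : ℕ) :
    ∑ d ∈ range (2 * n), hBack n (d + 1) ^ 2 / ((d : ℝ) + 1) = h3 n := by
  induction n with
  | zero => simp
  | succ n ih =>
    have h1 := sum_hBack_sq_succ_sub n (2 * n + 1)
    rw [Finset.sum_range_succ (fun d : ℕ => hBack n (d + 1) ^ 2 / ((d : ℝ) + 1)), ih,
      hBack_add_two_mul, h_succ] at h1
    have h0 := hBack_add_two_mul (n + 1) 0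
    rw [show 2 * (n + 1) = 2 * n + 1 + 1 by ring, Finset.sum_range_succ, h3_succ]
    rw [show 2 * (n + 1) + 0 = 2 * n + 1 + 1 by ring] at h0
    rw [h0]
    push_cast at h1 ⊢
    have e : h n - (h n + 1 / (2 * (n : ℝ) + 1)) = -(1 / (2 * (n : ℝ) + 1)) := by ring
    rw [e] at h1
    have e2 : (-(1 / (2 * (n : ℝ) + 1))) ^ 2 / (2 * (n : ℝ) + 1) = 1 / (2 * (n : ℝ) + 1) ^ 3 := by
      field_simp
    rw [neg_add_cancel, mul_zero, mul_zero, e2] at h1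
    rw [add_zero, sub_self]
    simp only [ne_eq, OfNat.ofNat_ne_zero, not_false_eq_true, zero_pow, zero_div, add_zero]
    linarith

/-- Forward difference of `h`. -/
noncomputable def hFwd (n d : ℕ) : ℝ := h (n + d) - h n

theorem hFwd_succ_sub (n d : ℕ) :
    hFwd (n + 1) d - hFwd n d = -(2 * (d : ℝ) / (2 * (n : ℝ) + 1)) * (hFwd n (d + 1) - hFwd n d) := by
  rw [hFwd, hFwd, hFwd, show n + 1 + d = n + d + 1 by ring, show n + (d + 1) = n + d + 1 by ring,
    h_succ (n + d), h_succ n]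
  push_cast
  field_simp
  ring

theorem hFwd_succ_left (n d : ℕ) :
    hFwd (n + 1) d = hFwd n (d + 1) - 1 / (2 * (n : ℝ) + 1) := by
  rw [hFwd, hFwd, show n + 1 + d = n + (d + 1) by ring, h_succ n]
  ring

theorem hFwd_one (n : ℕ) : hFwd n 1 = 1 / (2 * (n : ℝ) + 1) := by
  rw [hFwd, h_succ]; ring

theorem sum_hFwd_succ_sub (n D : ℕ) :
    ∑ d ∈ range D, hFwd (n + 1) (d + 1) / ((d : ℝ) + 1)
      - ∑ d ∈ range D, hFwd n (d + 1) / ((d : ℝ) + 1)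
      = -(2 / (2 * (n : ℝ) + 1)) * (hFwd n (D + 1) - 1 / (2 * (n : ℝ) + 1)) := by
  induction D with
  | zero => simp [hFwd_one]
  | succ D ih =>
    rw [Finset.sum_range_succ, Finset.sum_range_succ]
    have h1 := hFwd_succ_sub n (D + 1)
    have h2 : hFwd (n + 1) (D + 1) / ((D : ℝ) + 1) - hFwd n (D + 1) / ((D : ℝ) + 1)
        = -(2 / (2 * (n : ℝ) + 1)) * (hFwd n (D + 1 + 1) - hFwd n (D + 1)) := by
      rw [← sub_div, h1]
      push_cast
      field_simp
    linarith

theorem sum_hFwd_sq_succ_sub (n D : ℕ) :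
    ∑ d ∈ range D, hFwd (n + 1) (d + 1) ^ 2 / ((d : ℝ) + 1)
      - ∑ d ∈ range D, hFwd n (d + 1) ^ 2 / ((d : ℝ) + 1)
      = -(2 / (2 * (n : ℝ) + 1)) * (hFwd n (D + 1) * (hFwd n (D + 1) - 1 / (2 * (n : ℝ) + 1))) := by
  induction D with
  | zero => simp [hFwd_one]
  | succ D ih =>
    rw [Finset.sum_range_succ, Finset.sum_range_succ]
    have h1 := hFwd_succ_sub n (D + 1)
    have h2 : hFwd (n + 1) (D + 1) ^ 2 / ((D : ℝ) + 1) - hFwd n (D + 1) ^ 2 / ((D : ℝ) + 1)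
        = -(2 / (2 * (n : ℝ) + 1)) * (hFwd n (D + 1 + 1) - hFwd n (D + 1))
          * (hFwd n (D + 1 + 1) + hFwd n (D + 1) - 1 / (2 * (n : ℝ) + 1)) := by
      rw [← sub_div, sq_sub_sq, h1, hFwd_succ_left]
      push_cast
      field_simp
      ring
    linear_combination ih + h2

open Filter Topology in
theorem tendsto_h_div : Tendsto (fun j : ℕ => h j / (j : ℝ)) atTop (𝓝 0) := by
  have h1 : Tendsto (fun j : ℕ => 1 / (2 * (j : ℝ) + 1)) atTop (𝓝 0) := by
    refine squeeze_zero (fun j => by positivity) (fun j => ?_)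
      tendsto_one_div_add_atTop_nhds_zero_nat
    apply one_div_le_one_div_of_le (by positivity)
    linarith [(by positivity : (0 : ℝ) ≤ j)]
  refine h1.cesaro.congr fun j => ?_
  rw [h]
  ring

open Filter Topology in
theorem tendsto_h_sq_div : Tendsto (fun j : ℕ => h j ^ 2 / (j : ℝ)) atTop (𝓝 0) := by
  have h1 : Tendsto (fun j : ℕ => h (j + 1) ^ 2 - h j ^ 2) atTop (𝓝 0) := by
    have h2 : Tendsto (fun j : ℕ => 1 / ((j : ℝ) + 1) + h j / (j : ℝ)) atTop (𝓝 (0 + 0)) :=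
      tendsto_one_div_add_atTop_nhds_zero_nat.add tendsto_h_div
    rw [add_zero] at h2
    refine squeeze_zero' (Eventually.of_forall fun j => ?_) ?_ h2
    · rw [h_succ]
      have := h_nonneg j
      have : (0 : ℝ) ≤ 1 / (2 * (j : ℝ) + 1) := by positivity
      nlinarith
    · filter_upwards [eventually_gt_atTop 0] with j hj
      have hj' : (0 : ℝ) < j := by exact_mod_cast hj
      have h0 := h_nonneg j
      rw [h_succ]
      have e : (h j + 1 / (2 * (j : ℝ) + 1)) ^ 2 - h j ^ 2
          = 1 / (2 * (j : ℝ) + 1) ^ 2 + h j * (2 / (2 * (j : ℝ) + 1)) := by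
        field_simp
        ring
      rw [e]
      have e1 : 1 / (2 * (j : ℝ) + 1) ^ 2 ≤ 1 / ((j : ℝ) + 1) := by
        apply one_div_le_one_div_of_le (by positivity)
        nlinarith
      have e2 : 2 / (2 * (j : ℝ) + 1) ≤ 1 / j := by
        rw [div_le_div_iff₀ (by positivity) hj']
        linarith
      have e3 := mul_le_mul_of_nonneg_left e2 h0
      rw [mul_one_div] at e3
      linarith
  refine h1.cesaro.congr fun j => ?_
  rw [Finset.sum_range_sub (fun i => h i ^ 2)]
  simp
  ring

open Filter Topology in
theorem tendsto_div_add_of_tendsto_div {f : ℕ → ℝ} (hf : ∀ j, 0 ≤ f j)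
    (hl : Tendsto (fun j : ℕ => f j / (j : ℝ)) atTop (𝓝 0)) (c : ℕ) :
    Tendsto (fun j : ℕ => f j / ((j : ℝ) + c)) atTop (𝓝 0) := by
  refine squeeze_zero' (Eventually.of_forall fun j => div_nonneg (hf j) (by positivity)) ?_ hl
  filter_upwards [eventually_gt_atTop 0] with j hj
  have hj' : (0 : ℝ) < j := by exact_mod_cast hj
  apply div_le_div_of_nonneg_left (hf j) hj'
  linarith [(by positivity : (0 : ℝ) ≤ c)]

open Filter Topology in
theorem tendsto_hBack_div (n : ℕ) :
    Tendsto (fun d : ℕ => hBack n d / (d : ℝ)) atTop (𝓝 0) := by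
  rw [← tendsto_add_atTop_iff_nat n]
  have h1 := (tendsto_div_add_of_tendsto_div (f := fun _ => h n) (fun _ => h_nonneg n)
    (tendsto_const_div_atTop_nhds_zero_nat _) n).sub
    (tendsto_div_add_of_tendsto_div h_nonneg tendsto_h_div n)
  rw [sub_zero] at h1
  refine h1.congr fun j => ?_
  rw [add_comm j n, hBack_add]
  push_cast
  ring

open Filter Topology in
theorem tendsto_hBack_sq_div (n : ℕ) :
    Tendsto (fun d : ℕ => hBack n d ^ 2 / (d : ℝ)) atTop (𝓝 0) := by
  rw [← tendsto_add_atTop_iff_nat n]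
  have h1 := ((tendsto_div_add_of_tendsto_div (f := fun _ => h n ^ 2) (fun _ => sq_nonneg _)
    (tendsto_const_div_atTop_nhds_zero_nat _) n).sub
    ((tendsto_div_add_of_tendsto_div h_nonneg tendsto_h_div n).const_mul (2 * h n))).add
    (tendsto_div_add_of_tendsto_div (fun j => sq_nonneg (h j)) tendsto_h_sq_div n)
  rw [mul_zero, sub_zero, add_zero] at h1
  refine h1.congr fun j => ?_
  rw [add_comm j n, hBack_add]
  push_cast
  ring

open Filter Topology in
theorem tendsto_h_shift_sub (c : ℕ) :
    Tendsto (fun j : ℕ => h (j + c) - h j) atTop (𝓝 0) := by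
  induction c with
  | zero => simp
  | succ c ih =>
    have h1 : Tendsto (fun j : ℕ => 1 / (2 * ((j + c : ℕ) : ℝ) + 1)) atTop (𝓝 0) := by
      refine squeeze_zero (fun j => by positivity) (fun j => ?_)
        tendsto_one_div_add_atTop_nhds_zero_nat
      apply one_div_le_one_div_of_le (by positivity)
      push_cast
      linarith [(by positivity : (0 : ℝ) ≤ j), (by positivity : (0 : ℝ) ≤ c)]
    have h2 := ih.add h1
    rw [add_zero] at h2
    refine h2.congr fun j => ?_
    rw [← add_assoc, h_succ]
    ring

open Filter Topology in
theorem tendsto_h_mul_h_shift_sub (c : ℕ) :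
    Tendsto (fun j : ℕ => h j * (h (j + c) - h j)) atTop (𝓝 0) := by
  induction c with
  | zero => simp
  | succ c ih =>
    have h1 : Tendsto (fun j : ℕ => h j * (1 / (2 * ((j + c : ℕ) : ℝ) + 1))) atTop (𝓝 0) := by
      have := tendsto_div_add_of_tendsto_div h_nonneg tendsto_h_div 1
      refine squeeze_zero (fun j => mul_nonneg (h_nonneg j) (by positivity)) (fun j => ?_) this
      rw [div_eq_mul_one_div (h j)]
      refine mul_le_mul_of_nonneg_left ?_ (h_nonneg j)
      apply one_div_le_one_div_of_le (by positivity)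
      push_cast
      linarith [(by positivity : (0 : ℝ) ≤ j), (by positivity : (0 : ℝ) ≤ c)]
    have h2 := ih.add h1
    rw [add_zero] at h2
    refine h2.congr fun j => ?_
    rw [← add_assoc, h_succ]
    ring

open Filter Topology in
theorem tendsto_hFwd_add_hBack (n : ℕ) :
    Tendsto (fun D : ℕ => hFwd n (D + 1) + hBack n D) atTop (𝓝 0) := by
  rw [← tendsto_add_atTop_iff_nat n]
  refine (tendsto_h_shift_sub (2 * n + 1)).congr fun j => ?_
  rw [add_comm j n, hBack_add, hFwd, show n + (n + j + 1) = j + (2 * n + 1) by ring]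
  ring

open Filter Topology in
theorem tendsto_hFwd_sq_sub_hBack_sq (n : ℕ) :
    Tendsto (fun D : ℕ => hFwd n (D + 1) * (hFwd n (D + 1) - 1 / (2 * (n : ℝ) + 1))
      - hBack n D * (hBack n D + 1 / (2 * (n : ℝ) + 1))) atTop (𝓝 0) := by
  rw [← tendsto_add_atTop_iff_nat n]
  have h1 := tendsto_h_shift_sub (2 * n + 1)
  have h2 := ((h1.mul h1).add ((tendsto_h_mul_h_shift_sub (2 * n + 1)).const_mul 2)).sub
    (h1.const_mul (2 * h n + 1 / (2 * (n : ℝ) + 1)))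
  simp only [mul_zero, add_zero, sub_zero] at h2
  refine h2.congr fun j => ?_
  rw [add_comm j n, hBack_add, hFwd, show n + (n + j + 1) = j + (2 * n + 1) by ring]
  ring

open Filter Topology in
theorem tendsto_sum_hFwd_add_hBack (n : ℕ) :
    Tendsto (fun D : ℕ => ∑ d ∈ range D, hFwd n (d + 1) / ((d : ℝ) + 1)
      + ∑ d ∈ range D, hBack n (d + 1) / ((d : ℝ) + 1)) atTop (𝓝 (2 * h2 n)) := by
  induction n with
  | zero =>
    have e : ∀ d, hBack 0 d = - hFwd 0 d := fun d => by
      have := hBack_add 0 d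
      rw [zero_add] at this
      rw [this, hFwd, zero_add]
      ring
    simp [e, neg_div]
  | succ n ih =>
    have h1 := ih.sub (((tendsto_hFwd_add_hBack n).sub_const
      (1 / (2 * (n : ℝ) + 1))).const_mul (2 / (2 * (n : ℝ) + 1)))
    have e : 2 * h2 (n + 1)
        = 2 * h2 n - 2 / (2 * (n : ℝ) + 1) * (0 - 1 / (2 * (n : ℝ) + 1)) := by
      rw [h2_succ]; field_simp; ring
    rw [e]
    refine h1.congr fun D => ?_
    linear_combination -sum_hFwd_succ_sub n D - sum_hBack_succ_sub n D

open Filter Topology in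
theorem tendsto_sum_hFwd_sq_sub_hBack_sq (n : ℕ) :
    Tendsto (fun D : ℕ => ∑ d ∈ range D, hFwd n (d + 1) ^ 2 / ((d : ℝ) + 1)
      - ∑ d ∈ range D, hBack n (d + 1) ^ 2 / ((d : ℝ) + 1)) atTop (𝓝 0) := by
  induction n with
  | zero =>
    have e : ∀ d, hBack 0 d = - hFwd 0 d := fun d => by
      have := hBack_add 0 d
      rw [zero_add] at this
      rw [this, hFwd, zero_add]
      ring
    simp [e]
  | succ n ih =>
    have h1 := ih.sub ((tendsto_hFwd_sq_sub_hBack_sq n).const_mul (2 / (2 * (n : ℝ) + 1)))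
    rw [mul_zero, sub_zero] at h1
    refine h1.congr fun D => ?_
    linear_combination -sum_hFwd_sq_succ_sub n D + sum_hBack_sq_succ_sub n D

open Filter Topology in
theorem tendsto_sum_shift_sub {g : ℕ → ℝ} (hg : Tendsto g atTop (𝓝 0)) (c : ℕ) :
    Tendsto (fun D : ℕ => ∑ d ∈ range (c + D), g d - ∑ d ∈ range D, g d) atTop (𝓝 0) := by
  have h1 : Tendsto (fun D : ℕ => ∑ i ∈ range c, g (D + i)) atTop (𝓝 (∑ i ∈ range c, (0 : ℝ))) := by
    refine tendsto_finsetSum _ fun i _ => ?_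
    exact (tendsto_add_atTop_iff_nat i).mpr hg
  rw [Finset.sum_const_zero] at h1
  refine h1.congr fun D => ?_
  rw [add_comm c D, Finset.sum_range_add]
  ring

theorem h_mono {m n : ℕ} (hmn : m ≤ n) : h m ≤ h n := by
  rw [h, h]
  exact Finset.sum_le_sum_of_subset_of_nonneg (by simpa using hmn) fun _ _ _ => by positivity

theorem hasSum_h_sub_div_sq_sub (n : ℕ) :
    HasSum (fun d : ℕ => (h (n + 1 + (d + 1)) - h (n + 1))
      / (((n + 1 + (d + 1) : ℕ) : ℝ) ^ 2 - ((n : ℝ) + 1) ^ 2))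
      (h2 (n + 1) / (2 * ((n : ℝ) + 1))) := by
  have hpos : ∀ d : ℕ, ((n + 1 + (d + 1) : ℕ) : ℝ) ^ 2 - ((n : ℝ) + 1) ^ 2
      = ((d : ℝ) + 1) * (2 * ((n : ℝ) + 1) + d + 1) := fun d => by push_cast; ring
  rw [hasSum_iff_tendsto_nat_of_nonneg]
  · have h1 := (((tendsto_sum_hFwd_add_hBack (n + 1)).add (tendsto_sum_shift_sub
      ((Filter.tendsto_add_atTop_iff_nat 1).mpr (tendsto_hBack_div (n + 1))) (2 * (n + 1)))).sub_const
      (h2 (n + 1))).mul_const (1 / (2 * ((n : ℝ) + 1)))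
    have e : (2 * h2 (n + 1) + 0 - h2 (n + 1)) * (1 / (2 * ((n : ℝ) + 1)))
      = h2 (n + 1) / (2 * ((n : ℝ) + 1)) := by ring
    rw [e] at h1
    refine h1.congr fun D => ?_
    have h3 := sum_hBack_two_mul (n + 1)
    simp only [Nat.cast_succ]
    rw [Finset.sum_range_add _ (2 * (n + 1)) D, h3]
    have e2 : ∀ A B C : ℝ, A + B + (C + h2 (n + 1) - B) - h2 (n + 1) = A + C := by intros; ring
    rw [add_comm (h2 (n + 1)), e2, ← Finset.sum_add_distrib, Finset.sum_mul]
    refine Finset.sum_congr rfl fun d _ => ?_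
    have h4 := hBack_add_two_mul (n + 1) (d + 1)
    rw [add_assoc (2 * (n + 1)) d 1, h4, hFwd, hpos]
    push_cast
    field_simp
    ring
  · intro d
    rw [hpos]
    exact div_nonneg (sub_nonneg.mpr (h_mono (by omega))) (by positivity)

theorem hasSum_h_sub_sq_div_sq_sub (n : ℕ) :
    HasSum (fun d : ℕ => (h (n + 1 + (d + 1)) - h (n + 1)) ^ 2
      / (((n + 1 + (d + 1) : ℕ) : ℝ) ^ 2 - ((n : ℝ) + 1) ^ 2))
      (h3 (n + 1) / (2 * ((n : ℝ) + 1))) := by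
  have hpos : ∀ d : ℕ, ((n + 1 + (d + 1) : ℕ) : ℝ) ^ 2 - ((n : ℝ) + 1) ^ 2
      = ((d : ℝ) + 1) * (2 * ((n : ℝ) + 1) + d + 1) := fun d => by push_cast; ring
  rw [hasSum_iff_tendsto_nat_of_nonneg]
  · have h1 := (((tendsto_sum_hFwd_sq_sub_hBack_sq (n + 1)).sub (tendsto_sum_shift_sub
      ((Filter.tendsto_add_atTop_iff_nat 1).mpr (tendsto_hBack_sq_div (n + 1)))
      (2 * (n + 1)))).add_const (h3 (n + 1))).mul_const (1 / (2 * ((n : ℝ) + 1)))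
    have e : (0 - 0 + h3 (n + 1)) * (1 / (2 * ((n : ℝ) + 1)))
      = h3 (n + 1) / (2 * ((n : ℝ) + 1)) := by ring
    rw [e] at h1
    refine h1.congr fun D => ?_
    have h3' := sum_hBack_sq_two_mul (n + 1)
    simp only [Nat.cast_succ]
    rw [Finset.sum_range_add _ (2 * (n + 1)) D, h3']
    have e2 : ∀ A B C : ℝ, A - B - (C + h3 (n + 1) - B) + h3 (n + 1) = A - C := by intros; ring
    rw [add_comm (h3 (n + 1)), e2, ← Finset.sum_sub_distrib, Finset.sum_mul]
    refine Finset.sum_congr rfl fun d _ => ?_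
    have h4 := hBack_add_two_mul (n + 1) (d + 1)
    rw [add_assoc (2 * (n + 1)) d 1, h4, hFwd, hpos]
    push_cast
    field_simp
    ring
  · intro d
    rw [hpos]
    exact div_nonneg (sq_nonneg _) (by positivity)

theorem sum_range_two_mul_split (f : ℕ → ℝ) (m : ℕ) :
    ∑ d ∈ range (2 * (m + 1)), f (d + 1)
      = ∑ k ∈ range m, (f (m + 1 - (k + 1)) + f (m + 1 + (k + 1))) + f (m + 1)
        + f (2 * (m + 1)) := by
  rw [show 2 * (m + 1) = m + 1 + m + 1 by ring, Finset.sum_range_succ, Finset.sum_range_add,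
    Finset.sum_range_succ, ← Finset.sum_range_reflect, Finset.sum_add_distrib]
  have e1 : ∑ j ∈ range m, f (m - 1 - j + 1) = ∑ k ∈ range m, f (m + 1 - (k + 1)) :=
    Finset.sum_congr rfl fun k hk => by
      rw [show m - 1 - k + 1 = m + 1 - (k + 1) by have := mem_range.mp hk; omega]
  have e2 : ∑ j ∈ range m, f (m + 1 + j + 1) = ∑ k ∈ range m, f (m + 1 + (k + 1)) := rfl
  rw [e1, e2]
  ring

theorem hBack_two_mul (n : ℕ) : hBack n (2 * n) = 0 := by
  have := hBack_add_two_mul n 0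
  simpa using this

theorem hBack_self (n : ℕ) : hBack n n = h n := by
  have := hBack_add n 0
  simpa using this

theorem sum_h_sub_div_sq_sub (m : ℕ) :
    ∑ k ∈ range m, (h (m + 1) - h (k + 1)) / (((m : ℝ) + 1) ^ 2 - ((k : ℝ) + 1) ^ 2)
      = h2 (m + 1) / (2 * ((m : ℝ) + 1)) - h (m + 1) / (2 * ((m : ℝ) + 1) ^ 2) := by
  have h1 := sum_hBack_two_mul (m + 1)
  have h0 := sum_range_two_mul_split (fun d => hBack (m + 1) d / (d : ℝ)) m
  simp only [Nat.cast_succ] at h0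
  rw [h0, hBack_two_mul, hBack_self, zero_div, add_zero] at h1
  have e : ∑ k ∈ range m, (hBack (m + 1) (m + 1 - (k + 1)) / ((m + 1 - (k + 1) : ℕ) : ℝ)
      + hBack (m + 1) (m + 1 + (k + 1)) / ((m + 1 + (k + 1) : ℕ) : ℝ))
      = (2 * ((m : ℝ) + 1)) * ∑ k ∈ range m, (h (m + 1) - h (k + 1))
        / (((m : ℝ) + 1) ^ 2 - ((k : ℝ) + 1) ^ 2) := by
    rw [Finset.mul_sum]
    refine Finset.sum_congr rfl fun k hk => ?_
    have hk' := mem_range.mp hk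
    rw [hBack_sub (by omega), hBack_add, Nat.cast_sub (by omega)]
    push_cast
    have hkm : (k : ℝ) < m := by exact_mod_cast hk'
    have n1 : (m : ℝ) + 1 - (k + 1) ≠ 0 := by linarith
    have n2 : (m : ℝ) + 1 + (k + 1) ≠ 0 := by positivity
    rw [show ((m : ℝ) + 1) ^ 2 - (k + 1) ^ 2 = ((m : ℝ) + 1 - (k + 1)) * (m + 1 + (k + 1)) by ring]
    field_simp
    ring
  rw [e] at h1
  field_simp at h1 ⊢
  linear_combination h1

theorem sum_h_sub_sq_div_sq_sub (m : ℕ) :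
    ∑ k ∈ range m, (h (m + 1) - h (k + 1)) ^ 2 / (((m : ℝ) + 1) ^ 2 - ((k : ℝ) + 1) ^ 2)
      = h3 (m + 1) / (2 * ((m : ℝ) + 1)) - h (m + 1) ^ 2 / (2 * ((m : ℝ) + 1) ^ 2) := by
  have h1 := sum_hBack_sq_two_mul (m + 1)
  have h0 := sum_range_two_mul_split (fun d => hBack (m + 1) d ^ 2 / (d : ℝ)) m
  simp only [Nat.cast_succ] at h0
  rw [h0, hBack_two_mul, hBack_self, zero_pow two_ne_zero, zero_div, add_zero] at h1
  have e : ∑ k ∈ range m, (hBack (m + 1) (m + 1 - (k + 1)) ^ 2 / ((m + 1 - (k + 1) : ℕ) : ℝ)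
      + hBack (m + 1) (m + 1 + (k + 1)) ^ 2 / ((m + 1 + (k + 1) : ℕ) : ℝ))
      = (2 * ((m : ℝ) + 1)) * ∑ k ∈ range m, (h (m + 1) - h (k + 1)) ^ 2
        / (((m : ℝ) + 1) ^ 2 - ((k : ℝ) + 1) ^ 2) := by
    rw [Finset.mul_sum]
    refine Finset.sum_congr rfl fun k hk => ?_
    have hk' := mem_range.mp hk
    rw [hBack_sub (by omega), hBack_add, Nat.cast_sub (by omega)]
    push_cast
    have hkm : (k : ℝ) < m := by exact_mod_cast hk'
    have n1 : (m : ℝ) + 1 - (k + 1) ≠ 0 := by linarith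
    have n2 : (m : ℝ) + 1 + (k + 1) ≠ 0 := by positivity
    rw [show ((m : ℝ) + 1) ^ 2 - (k + 1) ^ 2 = ((m : ℝ) + 1 - (k + 1)) * (m + 1 + (k + 1)) by ring]
    field_simp
    ring
  rw [e] at h1
  field_simp at h1 ⊢
  linear_combination h1

theorem hasSum_mul_triangle {f g : ℕ → ℝ} {a b : ℝ} (hf0 : ∀ n, 0 ≤ f n) (hg0 : ∀ n, 0 ≤ g n)
    (hf : HasSum f a) (hg : HasSum g b) :
    HasSum (fun n => ∑ m ∈ range n, (f m * g n + f n * g m) + f n * g n) (a * b) := by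
  rw [hasSum_iff_tendsto_nat_of_nonneg]
  · refine (hf.tendsto_sum_nat.mul hg.tendsto_sum_nat).congr fun n => ?_
    induction n with
    | zero => simp
    | succ n ih =>
      rw [Finset.sum_range_succ, Finset.sum_range_succ, Finset.sum_range_succ, ← ih,
        Finset.sum_add_distrib, ← Finset.sum_mul, ← Finset.mul_sum]
      ring
  · intro n
    exact add_nonneg (Finset.sum_nonneg fun m _ => add_nonneg (mul_nonneg (hf0 _) (hg0 _))
      (mul_nonneg (hf0 _) (hg0 _))) (mul_nonneg (hf0 _) (hg0 _))

theorem sq_sub_sq_pos {m n : ℕ} (hmn : m < n) : (0 : ℝ) < ((n : ℝ) + 1) ^ 2 - ((m : ℝ) + 1) ^ 2 := by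
  have : (m : ℝ) < n := by exact_mod_cast hmn
  have : (0 : ℝ) ≤ m := by positivity
  nlinarith

theorem summable_h_sq_div_pow_four :
    Summable fun k : ℕ => h (k + 1) ^ 2 / ((k : ℝ) + 1) ^ 4 := by
  refine Summable.of_nonneg_of_le (fun n => by positivity) (fun n => ?_)
    hasSum_h_sq_div_sq.summable
  apply div_le_div_of_nonneg_left (sq_nonneg _) (by positivity)
  exact pow_le_pow_right₀ (by linarith [(by positivity : (0 : ℝ) ≤ n)]) (by norm_num)

theorem hasSum_h_sq_div_pow_four :
    HasSum (fun k : ℕ => h (k + 1) ^ 2 / ((k : ℝ) + 1) ^ 4)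
      (2 * zeta 2 * (2 * (3 / 4 * zeta 2) ^ 2) - 2 * (7 / 4 * zeta 3) ^ 2) := by
  obtain ⟨w, hw⟩ := summable_h_sq_div_pow_four
  obtain ⟨v, hv⟩ := summable_div_pow_of_le (s := 3) (C := 2) (by norm_num) h3_nonneg
    (fun n => (h3_le_h2 n).trans (h2_le n))
  have hrow := hasSum_triangle (f := fun m n : ℕ => (h (n + 1) - h (m + 1)) ^ 2
      / (((n : ℝ) + 1) ^ 2 - ((m : ℝ) + 1) ^ 2) * (1 / ((m : ℝ) + 1) ^ 2))
    (r := fun m : ℕ => h3 (m + 1) / ((m : ℝ) + 1) ^ 3 * (1 / 2))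
    (fun m n hmn => mul_nonneg (div_nonneg (sq_nonneg _) (sq_sub_sq_pos hmn).le) (by positivity))
    (fun m => ((hasSum_h_sub_sq_div_sq_sub m).mul_right (1 / ((m : ℝ) + 1) ^ 2)).of_eq
      (fun d => by
        rw [show m + 1 + d + 1 = m + 1 + (d + 1) by ring]
        push_cast
        ring_nf) (by field_simp))
    (hv.mul_right (1 / 2))
  have hcol : HasSum (fun n : ℕ => ∑ m ∈ range n, (h (n + 1) - h (m + 1)) ^ 2
      / (((n : ℝ) + 1) ^ 2 - ((m : ℝ) + 1) ^ 2) * (1 / ((n : ℝ) + 1) ^ 2))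
      (v * (1 / 2) - w * (1 / 2)) :=
    ((hv.mul_right (1 / 2)).sub (hw.mul_right (1 / 2))).of_eq (fun n => by
      rw [← Finset.sum_mul, sum_h_sub_sq_div_sq_sub]
      field_simp) rfl
  have hdiff := hrow.sub hcol
  have hT := hasSum_mul_triangle (fun n => by have := h_nonneg (n + 1); positivity)
    (fun n => by have := h_nonneg (n + 1); positivity) hasSum_h_div_sq hasSum_h_div_sq
  have hU := hasSum_mul_triangle (fun n => by positivity) (fun n => by positivity)
    hasSum_h_sq_div_sq (hasSum_zeta (s := 2) le_rfl)
  have key := (hdiff.unique ((hU.sub hT).of_eq (fun n => ?_) rfl))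
  · refine hw.of_eq (fun _ => rfl) ?_
    linarith
  · rw [← Finset.sum_sub_distrib, add_sub_add_comm, ← Finset.sum_sub_distrib]
    have e : h (n + 1) ^ 2 / ((n : ℝ) + 1) ^ 2 * (1 / ((n : ℝ) + 1) ^ 2)
        - h (n + 1) / ((n : ℝ) + 1) ^ 2 * (h (n + 1) / ((n : ℝ) + 1) ^ 2) = 0 := by ring
    rw [e, add_zero]
    refine Finset.sum_congr rfl fun m hm => ?_
    have hd := (sq_sub_sq_pos (mem_range.mp hm)).ne'
    field_simp
    ring

theorem sum_inv_sq_sub_sq (m : ℕ) :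
    ∑ k ∈ range m, 1 / (((m : ℝ) + 1) ^ 2 - ((k : ℝ) + 1) ^ 2)
      = H (2 * (m + 1)) / (2 * ((m : ℝ) + 1)) - 3 / (4 * ((m : ℝ) + 1) ^ 2) := by
  have h0 := sum_range_two_mul_split (fun d => 1 / (d : ℝ)) m
  have h1 : H (2 * (m + 1)) = ∑ d ∈ range (2 * (m + 1)), 1 / (((d + 1 : ℕ) : ℝ)) := by
    simp [H]
  rw [h0] at h1
  have e : ∑ k ∈ range m, (1 / ((m + 1 - (k + 1) : ℕ) : ℝ) + 1 / ((m + 1 + (k + 1) : ℕ) : ℝ))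
      = (2 * ((m : ℝ) + 1)) * ∑ k ∈ range m, 1 / (((m : ℝ) + 1) ^ 2 - ((k : ℝ) + 1) ^ 2) := by
    rw [Finset.mul_sum]
    refine Finset.sum_congr rfl fun k hk => ?_
    have hk' := mem_range.mp hk
    rw [Nat.cast_sub (by omega)]
    push_cast
    have hkm : (k : ℝ) < m := by exact_mod_cast hk'
    have n1 : (m : ℝ) + 1 - (k + 1) ≠ 0 := by linarith
    have n2 : (m : ℝ) + 1 + (k + 1) ≠ 0 := by positivity
    rw [show ((m : ℝ) + 1) ^ 2 - (k + 1) ^ 2 = ((m : ℝ) + 1 - (k + 1)) * (m + 1 + (k + 1)) by ring]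
    field_simp
    ring
  rw [e] at h1
  rw [h1]
  push_cast
  field_simp
  ring

theorem hasSum_h_mul_h2_div_pow_three {c w : ℝ}
    (hc : HasSum (fun k : ℕ => h (k + 1) * h2 (k + 1) / ((k : ℝ) + 1) ^ 3) c)
    (hw : HasSum (fun k : ℕ => h (k + 1) ^ 2 / ((k : ℝ) + 1) ^ 4) w) :
    4 * c + 3 * w = 2 * (7 / 4 * zeta 3) ^ 2 := by
  have hrow := hasSum_triangle (f := fun m n : ℕ => (h (n + 1) - h (m + 1))
      / (((n : ℝ) + 1) ^ 2 - ((m : ℝ) + 1) ^ 2) * (h (m + 1) / ((m : ℝ) + 1) ^ 2))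
    (r := fun m : ℕ => h (m + 1) * h2 (m + 1) / ((m : ℝ) + 1) ^ 3 * (1 / 2))
    (fun m n hmn => mul_nonneg (div_nonneg (sub_nonneg.mpr (h_mono (by omega)))
      (sq_sub_sq_pos hmn).le) (div_nonneg (h_nonneg _) (by positivity)))
    (fun m => ((hasSum_h_sub_div_sq_sub m).mul_right (h (m + 1) / ((m : ℝ) + 1) ^ 2)).of_eq
      (fun d => by
        rw [show m + 1 + d + 1 = m + 1 + (d + 1) by ring]
        push_cast
        ring_nf) (by field_simp))
    (hc.mul_right (1 / 2))
  have hcol : HasSum (fun n : ℕ => ∑ m ∈ range n, (h (n + 1) - h (m + 1))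
      / (((n : ℝ) + 1) ^ 2 - ((m : ℝ) + 1) ^ 2) * (h (n + 1) / ((n : ℝ) + 1) ^ 2))
      (c * (1 / 2) - w * (1 / 2)) :=
    ((hc.mul_right (1 / 2)).sub (hw.mul_right (1 / 2))).of_eq (fun n => by
      rw [← Finset.sum_mul, sum_h_sub_div_sq_sub]
      field_simp) rfl
  have hT := hasSum_mul_triangle (fun n => by have := h_nonneg (n + 1); positivity)
    (fun n => by have := h_nonneg (n + 1); positivity) hasSum_h_div_sq hasSum_h_div_sq
  have hY : Summable fun k : ℕ => h (k + 1) ^ 2 / ((k : ℝ) + 1) ^ 2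
      * (H (2 * (k + 1)) / (2 * ((k : ℝ) + 1))) := by
    refine Summable.of_nonneg_of_le (fun n => ?_) (fun n => ?_) hasSum_h_sq_div_sq.summable
    · have := H_nonneg (2 * (n + 1))
      positivity
    · refine mul_le_of_le_one_right (by positivity) ?_
      rw [div_le_one (by positivity), H_two_mul]
      have h1 := h_le (n + 1)
      have h2' : H (n + 1) ≤ ((n + 1 : ℕ) : ℝ) := by
        rw [H]
        calc _ ≤ ∑ j ∈ range (n + 1), (1 : ℝ) := Finset.sum_le_sum fun j _ => by
              rw [div_le_one (by positivity)]
              linarith [(by positivity : (0 : ℝ) ≤ j)]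
          _ = _ := by simp
      push_cast at h1 h2'
      linarith
  obtain ⟨y, hy⟩ := hY
  have hP := hasSum_triangle (f := fun m n : ℕ => h (m + 1) ^ 2 / ((m : ℝ) + 1) ^ 2
      * (1 / (((n : ℝ) + 1) ^ 2 - ((m : ℝ) + 1) ^ 2)))
    (fun m n hmn => mul_nonneg (by positivity) (by have := sq_sub_sq_pos hmn; positivity))
    (fun m => (((hasSum_inv_mul_shift (2 * m + 1)).mul_left
      (h (m + 1) ^ 2 / ((m : ℝ) + 1) ^ 2))).of_eq
      (fun d => by
        push_cast
        rw [show ((m : ℝ) + 1 + d + 1) ^ 2 - (m + 1) ^ 2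
          = (d + 1) * (d + 1 + (2 * m + 1 + 1)) by ring]) (by
        rw [show 2 * (m + 1) = 2 * m + 1 + 1 by ring]
        push_cast
        ring_nf))
    hy
  have hN : HasSum (fun n : ℕ => ∑ m ∈ range n, h (n + 1) ^ 2 / ((n : ℝ) + 1) ^ 2
      * (1 / (((n : ℝ) + 1) ^ 2 - ((m : ℝ) + 1) ^ 2))) (y - w * (3 / 4)) :=
    (hy.sub (hw.mul_right (3 / 4))).of_eq (fun n => by
      rw [← Finset.mul_sum, sum_inv_sq_sub_sq]
      field_simp) rfl
  have key := (hrow.add hcol).unique ((((hT.sub hw).mul_right (1 / 2)).add (hN.sub hP)).of_eq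
    (fun n => ?_) rfl)
  · linarith
  · have e : h (n + 1) / ((n : ℝ) + 1) ^ 2 * (h (n + 1) / ((n : ℝ) + 1) ^ 2)
        - h (n + 1) ^ 2 / ((n : ℝ) + 1) ^ 4 = 0 := by field_simp; ring
    rw [← Finset.sum_add_distrib, add_sub_assoc, e, add_zero, Finset.sum_mul,
      ← Finset.sum_sub_distrib, ← Finset.sum_add_distrib]
    refine Finset.sum_congr rfl fun m hm => ?_
    have hd := (sq_sub_sq_pos (mem_range.mp hm)).ne'
    field_simp
    ring

/-- The product `(1 + x)ₙ / n!`. -/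
noncomputable def pochUp (x : ℝ) (n : ℕ) : ℝ := ∏ i ∈ range n, ((i : ℝ) + 1 + x) / ((i : ℝ) + 1)

/-- The product `(1 - x)ₙ / n!`. -/
noncomputable def pochDown (x : ℝ) (n : ℕ) : ℝ := pochUp (-x) n

/-- The product `(-x)ₙ / n!`. -/
noncomputable def pochNeg (x : ℝ) (n : ℕ) : ℝ := ∏ i ∈ range n, ((i : ℝ) - x) / ((i : ℝ) + 1)

@[simp] theorem pochUp_zero (x : ℝ) : pochUp x 0 = 1 := by simp [pochUp]

@[simp] theorem pochDown_zero (x : ℝ) : pochDown x 0 = 1 := by simp [pochDown]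

@[simp] theorem pochNeg_zero (x : ℝ) : pochNeg x 0 = 1 := by simp [pochNeg]

theorem succ_mul_pochUp_succ (x : ℝ) (n : ℕ) :
    ((n : ℝ) + 1) * pochUp x (n + 1) = ((n : ℝ) + 1 + x) * pochUp x n := by
  rw [pochUp, Finset.prod_range_succ, pochUp]
  field_simp

theorem succ_mul_pochNeg_succ (x : ℝ) (n : ℕ) :
    ((n : ℝ) + 1) * pochNeg x (n + 1) = ((n : ℝ) - x) * pochNeg x n := by
  rw [pochNeg, Finset.prod_range_succ, pochNeg]
  field_simp

theorem succ_mul_pochNeg_succ_eq (x : ℝ) (n : ℕ) :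
    ((n : ℝ) + 1) * pochNeg x (n + 1) = -x * pochDown x n := by
  induction n with
  | zero =>
    rw [succ_mul_pochNeg_succ]
    simp
  | succ n ih =>
    rw [succ_mul_pochNeg_succ]
    have h1 := succ_mul_pochUp_succ (-x) n
    rw [pochDown] at ih ⊢
    push_cast
    have h2 : (n : ℝ) + 1 ≠ 0 := by positivity
    apply mul_left_cancel₀ h2
    linear_combination ((n : ℝ) + 1 - x) * ih + x * h1

theorem pochUp_pos {x : ℝ} (hx : -1 < x) (n : ℕ) : 0 < pochUp x n :=
  Finset.prod_pos fun i _ => by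
    have : (0 : ℝ) ≤ i := by positivity
    exact div_pos (by linarith) (by positivity)

theorem pochUp_le_succ {x : ℝ} (hx : 0 ≤ x) (n : ℕ) : pochUp x n ≤ pochUp x (n + 1) := by
  have h1 := succ_mul_pochUp_succ x n
  have h2 := pochUp_pos (by linarith : -1 < x) n
  have h3 : (0 : ℝ) < (n : ℝ) + 1 := by positivity
  have : ((n : ℝ) + 1) * pochUp x n ≤ ((n : ℝ) + 1) * pochUp x (n + 1) := by nlinarith
  exact le_of_mul_le_mul_left this h3

theorem pochUp_mono {x : ℝ} (hx : 0 ≤ x) : Monotone (pochUp x) :=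
  monotone_nat_of_le_succ (pochUp_le_succ hx)

theorem one_le_pochUp {x : ℝ} (hx : 0 ≤ x) (n : ℕ) : 1 ≤ pochUp x n := by
  simpa using pochUp_mono hx (Nat.zero_le n)

theorem pochUp_le {x : ℝ} (hx : 0 ≤ x) (hx1 : x ≤ 1) (n : ℕ) : pochUp x n ≤ n + 1 := by
  induction n with
  | zero => simp
  | succ n ih =>
    have h1 := succ_mul_pochUp_succ x n
    have h3 : (0 : ℝ) < (n : ℝ) + 1 := by positivity
    push_cast
    have : ((n : ℝ) + 1) * pochUp x (n + 1) ≤ ((n : ℝ) + 1) * ((n : ℝ) + 1 + 1) := by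
      rw [h1]
      nlinarith [pochUp_pos (by linarith : -1 < x) n]
    exact le_of_mul_le_mul_left this h3

theorem pochDown_nonneg {x : ℝ} (hx1 : x < 1) (n : ℕ) : 0 ≤ pochDown x n :=
  (pochUp_pos (by linarith) n).le

theorem pochDown_le_one {x : ℝ} (hx : 0 ≤ x) (hx1 : x < 1) (n : ℕ) : pochDown x n ≤ 1 := by
  rw [pochDown, pochUp]
  exact Finset.prod_le_one
    (fun i _ => by
      have : (0 : ℝ) ≤ i := by positivity
      exact div_nonneg (by linarith) (by positivity))
    (fun i _ => by
      rw [div_le_one (by positivity)]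
      linarith)

theorem abs_pochNeg_le_one {x : ℝ} (hx : 0 ≤ x) (hx1 : x ≤ 1) (n : ℕ) : |pochNeg x n| ≤ 1 := by
  rw [pochNeg, Finset.abs_prod]
  refine Finset.prod_le_one (fun i _ => abs_nonneg _) fun i _ => ?_
  have : (0 : ℝ) ≤ i := by positivity
  rw [abs_div, div_le_one (by positivity), abs_le, abs_of_pos (by positivity : (0 : ℝ) < (i : ℝ) + 1)]
  constructor <;> linarith

/-- Summand of a terminating well-poised sum equal to one. -/
noncomputable def wellPoised (x : ℝ) (k i : ℕ) : ℝ :=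
  (2 * (i : ℝ) + 1 + x) * pochUp x i ^ 2 * pochNeg x (k - i)
    / (((k : ℝ) + i + 1) * pochUp x (k + i + 1))

/-- Telescoping companion of `wellPoised`. -/
noncomputable def wellPoisedAux (x : ℝ) (k i : ℕ) : ℝ :=
  -(2 / ((k : ℝ) + 1)) * ((i : ℝ) * pochUp x i) ^ 2 * pochNeg x (k + 1 - i)
    / (((k : ℝ) + i + 1) * pochUp x (k + i + 1))

theorem wellPoised_succ_sub {x : ℝ} (hx : 0 ≤ x) {k i : ℕ} (hi : i ≤ k) :
    wellPoised x (k + 1) i - wellPoised x k i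
      = wellPoisedAux x k (i + 1) - wellPoisedAux x k i := by
  obtain ⟨n, rfl⟩ := Nat.exists_eq_add_of_le hi
  rw [wellPoised, wellPoised, wellPoisedAux, wellPoisedAux, show i + n + 1 - i = n + 1 by omega,
    show i + n - i = n by omega, show i + n + 1 - (i + 1) = n by omega,
    show i + n + (i + 1) + 1 = i + n + i + 1 + 1 by ring,
    show i + n + 1 + i + 1 = i + n + i + 1 + 1 by ring]
  have h1 := succ_mul_pochUp_succ x i
  have h2 := succ_mul_pochUp_succ x (i + n + i + 1)
  have h3 := succ_mul_pochNeg_succ x n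
  have hA := pochUp_pos (by linarith : -1 < x) (i + n + i + 1)
  have hB : pochUp x (i + n + i + 1 + 1)
      = ((i + n + i + 1 : ℕ) + 1 + x) / ((i + n + i + 1 : ℕ) + 1) * pochUp x (i + n + i + 1) := by
    field_simp
    linear_combination h2
  have hC : pochNeg x (n + 1) = ((n : ℝ) - x) / (n + 1) * pochNeg x n := by
    field_simp
    linear_combination h3
  push_cast at hB ⊢
  rw [h1, hB, hC]
  generalize pochUp x (i + n + i + 1) = A at *
  generalize pochUp x i = a at *
  generalize pochNeg x n = b at *
  have hd : (0 : ℝ) < i + n + i + 1 + 1 + x := by positivity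
  field_simp
  ring

theorem sum_wellPoised {x : ℝ} (hx : 0 ≤ x) (k : ℕ) :
    ∑ i ∈ range (k + 1), wellPoised x k i = 1 := by
  induction k with
  | zero =>
    have h1 := succ_mul_pochUp_succ x 0
    simp [wellPoised] at h1 ⊢
    rw [h1]
    exact div_self (by positivity)
  | succ k ih =>
    have h1 : ∑ i ∈ range (k + 1), (wellPoised x (k + 1) i - wellPoised x k i)
        = wellPoisedAux x k (k + 1) := by
      rw [Finset.sum_congr rfl fun i hi => wellPoised_succ_sub hx
        (Nat.lt_succ_iff.mp (mem_range.mp hi)), Finset.sum_range_sub]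
      simp [wellPoisedAux]
    rw [Finset.sum_sub_distrib, ih] at h1
    rw [Finset.sum_range_succ]
    have h2 : wellPoised x (k + 1) (k + 1) + wellPoisedAux x k (k + 1) = 0 := by
      have h3 := succ_mul_pochUp_succ x (k + (k + 1) + 1)
      rw [wellPoised, wellPoisedAux, show k + 1 + (k + 1) + 1 = k + (k + 1) + 1 + 1 by ring]
      have hA := pochUp_pos (by linarith : -1 < x) (k + (k + 1) + 1)
      push_cast at h3 ⊢
      rw [show (k : ℝ) + 1 + (k + 1) + 1 = k + (k + 1) + 1 + 1 by ring, h3]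
      have hd : (0 : ℝ) < k + (k + 1) + 1 + 1 + x := by positivity
      simp
      field_simp
      ring
    linarith

/-- The kernel `(1 + x)ᵢ² (1 - x)ₖ₋₁₋ᵢ / (1 + x)ₖ₊ᵢ`, normalised by factorials. -/
noncomputable def pochKer (x : ℝ) (k i : ℕ) : ℝ :=
  pochUp x i ^ 2 * pochDown x (k - 1 - i) / pochUp x (k + i)

/-- The sum of the two partial fractions attached to an odd integer and its shift. -/
noncomputable def oddShift (x : ℝ) (i : ℕ) : ℝ := 2 / (2 * (i : ℝ) + 1) + 2 / (2 * (i : ℝ) + 1 + 2 * x)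

/-- The product of `(p - 2 * x) / (p + 2 * x)` over the first `k` odd `p`. -/
noncomputable def oddRatio (x : ℝ) (k : ℕ) : ℝ :=
  ∏ j ∈ range k, (2 * (j : ℝ) + 1 - 2 * x) / (2 * (j : ℝ) + 1 + 2 * x)

theorem oddRatio_succ (x : ℝ) (k : ℕ) : oddRatio x (k + 1)
    = oddRatio x k * ((2 * (k : ℝ) + 1 - 2 * x) / (2 * (k : ℝ) + 1 + 2 * x)) :=
  Finset.prod_range_succ _ _

theorem pochKer_succ_sub {x : ℝ} (hx : 0 < x) {k i : ℕ} (hi : i < k) :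
    x * ((2 * (k : ℝ) + 1 + 2 * x) * (pochKer x (k + 1) i * oddShift x i)
      - (2 * (k : ℝ) + 1 - 2 * x) * (pochKer x k i * oddShift x i)) = 4 * x * wellPoised x k i := by
  obtain ⟨n, rfl⟩ := Nat.exists_eq_add_of_lt hi
  rw [pochKer, pochKer, wellPoised, oddShift, show i + n + 1 - i = n + 1 by omega,
    show i + n + 1 - 1 - i = n by omega, show i + n + 1 + 1 - 1 - i = n + 1 by omega,
    show i + n + 1 + 1 + i = i + n + 1 + i + 1 by ring]
  have h2 := succ_mul_pochUp_succ x (i + n + 1 + i)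
  have h3 := succ_mul_pochNeg_succ_eq x n
  have h4 := succ_mul_pochUp_succ (-x) n
  have hA := pochUp_pos (by linarith : -1 < x) (i + n + 1 + i)
  have hB : pochUp x (i + n + 1 + i + 1)
      = ((i + n + 1 + i : ℕ) + 1 + x) / ((i + n + 1 + i : ℕ) + 1) * pochUp x (i + n + 1 + i) := by
    field_simp
    linear_combination h2
  have hC : pochNeg x (n + 1) = -x / (n + 1) * pochDown x n := by
    field_simp
    linear_combination h3
  have hD : pochDown x (n + 1) = ((n : ℝ) + 1 - x) / (n + 1) * pochDown x n := by
    rw [pochDown, pochDown]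
    field_simp
    linear_combination h4
  push_cast at hB ⊢
  rw [hB, hC, hD]
  generalize pochUp x (i + n + 1 + i) = A at *
  generalize pochUp x i = a at *
  generalize pochDown x n = b at *
  have hd : (0 : ℝ) < i + n + 1 + i + 1 + x := by positivity
  field_simp
  ring

theorem one_sub_oddRatio {x : ℝ} (hx : 0 < x) (k : ℕ) :
    1 - oddRatio x k = x * ∑ i ∈ range k, pochKer x k i * oddShift x i := by
  induction k with
  | zero => simp [oddRatio]
  | succ k ih =>
    have h1 := sum_wellPoised hx.le k
    rw [Finset.sum_range_succ] at h1
    have h2 : ∑ i ∈ range k, x * ((2 * (k : ℝ) + 1 + 2 * x) * (pochKer x (k + 1) i * oddShift x i)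
      - (2 * (k : ℝ) + 1 - 2 * x) * (pochKer x k i * oddShift x i))
        = ∑ i ∈ range k, 4 * x * wellPoised x k i :=
      Finset.sum_congr rfl fun i hi => pochKer_succ_sub hx (mem_range.mp hi)
    rw [← Finset.mul_sum, ← Finset.mul_sum, Finset.sum_sub_distrib, ← Finset.mul_sum,
      ← Finset.mul_sum] at h2
    have h3 : (2 * (k : ℝ) + 1 + 2 * x) * (pochKer x (k + 1) k * oddShift x k)
        = 4 * wellPoised x k k := by
      rw [pochKer, wellPoised, oddShift]
      have hA := pochUp_pos (by linarith : -1 < x) (k + 1 + k)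
      have h4 := succ_mul_pochUp_succ x (k + k)
      rw [show k + 1 + k = k + k + 1 by ring] at hA ⊢
      have hd : (0 : ℝ) < 2 * k + 1 + 2 * x := by positivity
      simp
      field_simp
      ring
    rw [oddRatio_succ, Finset.sum_range_succ]
    have hd : (0 : ℝ) < 2 * k + 1 + 2 * x := by positivity
    have h5 : (2 * (k : ℝ) + 1 + 2 * x) * (1 - oddRatio x k * ((2 * (k : ℝ) + 1 - 2 * x)
        / (2 * (k : ℝ) + 1 + 2 * x))) = 2 * (k : ℝ) + 1 + 2 * x
          - oddRatio x k * (2 * (k : ℝ) + 1 - 2 * x) := by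
      field_simp
    apply mul_left_cancel₀ hd.ne'
    rw [h5]
    linear_combination (2 * (k : ℝ) + 1 - 2 * x) * ih - h2 - x * h3 - 4 * x * h1

/-- Summand of a nonterminating well-poised series equal to one. -/
noncomputable def dixon (x : ℝ) (r n : ℕ) : ℝ :=
  2 * (r : ℝ) ^ 2 * pochUp x r ^ 2 * pochNeg x n
    / (((r : ℝ) + n) * (2 * (r : ℝ) + n) * pochUp x (2 * r + n))

/-- Telescoping companion of `dixon`. -/
noncomputable def dixonAux (x : ℝ) (r n : ℕ) : ℝ :=
  -(2 * (r : ℝ) + 1 + x) * pochUp x r ^ 2 * pochNeg x n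
    / ((2 * (r : ℝ) + n + 1) * pochUp x (2 * r + n + 1))

theorem dixon_succ_sub {x : ℝ} (hx : 0 ≤ x) (r n : ℕ) :
    dixon x (r + 1) n - dixon x r (n + 1) = dixonAux x r (n + 1) - dixonAux x r n := by
  rw [dixon, dixon, dixonAux, dixonAux, show 2 * r + (n + 1) + 1 = 2 * r + n + 1 + 1 by ring,
    show 2 * (r + 1) + n = 2 * r + n + 1 + 1 by ring, show 2 * r + (n + 1) = 2 * r + n + 1 by ring]
  have h1 := succ_mul_pochUp_succ x r
  have h2 := succ_mul_pochUp_succ x (2 * r + n + 1)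
  have h3 := succ_mul_pochNeg_succ x n
  have hA := pochUp_pos (by linarith : -1 < x) (2 * r + n + 1)
  have hB : pochUp x (2 * r + n + 1 + 1)
      = ((2 * r + n + 1 : ℕ) + 1 + x) / ((2 * r + n + 1 : ℕ) + 1) * pochUp x (2 * r + n + 1) := by
    field_simp
    linear_combination h2
  have hC : pochNeg x (n + 1) = ((n : ℝ) - x) / (n + 1) * pochNeg x n := by
    field_simp
    linear_combination h3
  have hD : pochUp x (r + 1) = ((r : ℝ) + 1 + x) / (r + 1) * pochUp x r := by
    field_simp
    linear_combination h1
  push_cast at hB ⊢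
  rw [hB, hC, hD]
  generalize pochUp x (2 * r + n + 1) = A at *
  generalize pochUp x r = a at *
  generalize pochNeg x n = b at *
  have hd : (0 : ℝ) < 2 * r + n + 1 + 1 + x := by positivity
  field_simp
  ring

theorem abs_dixon_le {x : ℝ} (hx : 0 ≤ x) (hx1 : x ≤ 1) (r n : ℕ) :
    |dixon x r (n + 1)| ≤ 2 * (r : ℝ) ^ 2 * pochUp x r ^ 2 * (1 / ((n : ℝ) + 1) ^ 2) := by
  have hA := one_le_pochUp hx (2 * r + (n + 1))
  have hB := abs_pochNeg_le_one hx hx1 (n + 1)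
  have hr : (0 : ℝ) ≤ r := by positivity
  have hn : (0 : ℝ) ≤ n := by positivity
  rw [dixon, abs_div, abs_mul, abs_of_nonneg (by positivity : 0 ≤ 2 * (r : ℝ) ^ 2 * pochUp x r ^ 2),
    mul_one_div]
  push_cast
  have hA0 := zero_lt_one.trans_le hA
  have hden : (0 : ℝ) < ((r : ℝ) + (n + 1)) * (2 * (r : ℝ) + (n + 1)) * pochUp x (2 * r + (n + 1)) := by
    positivity
  rw [abs_of_pos hden]
  apply div_le_div₀ (by positivity)
  · exact mul_le_of_le_one_right (by positivity) hB
  · positivity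
  · have h1 : ((n : ℝ) + 1) ^ 2 ≤ ((r : ℝ) + (n + 1)) * (2 * (r : ℝ) + (n + 1)) := by nlinarith
    exact h1.trans (le_mul_of_one_le_right (by positivity) hA)

open Filter Topology in
theorem tendsto_dixonAux {x : ℝ} (hx : 0 ≤ x) (hx1 : x ≤ 1) (r : ℕ) :
    Tendsto (dixonAux x r) atTop (𝓝 0) := by
  rw [tendsto_zero_iff_abs_tendsto_zero]
  have h1 := (tendsto_one_div_add_atTop_nhds_zero_nat (𝕜 := ℝ)).const_mul
    ((2 * (r : ℝ) + 1 + x) * pochUp x r ^ 2)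
  rw [mul_zero] at h1
  refine squeeze_zero (fun _ => abs_nonneg _) (fun n => ?_) h1
  have hA := one_le_pochUp hx (2 * r + n + 1)
  have hB := abs_pochNeg_le_one hx hx1 n
  have hr : (0 : ℝ) ≤ r := by positivity
  have hn : (0 : ℝ) ≤ n := by positivity
  simp only [Function.comp_apply]
  have hA0 := zero_lt_one.trans_le hA
  have hden : (0 : ℝ) < (2 * (r : ℝ) + n + 1) * pochUp x (2 * r + n + 1) := by positivity
  rw [dixonAux, abs_div, abs_mul, neg_mul, abs_neg,
    abs_of_nonneg (by positivity : 0 ≤ (2 * (r : ℝ) + 1 + x) * pochUp x r ^ 2), mul_one_div,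
    abs_of_pos hden]
  apply div_le_div₀ (by positivity)
  · exact mul_le_of_le_one_right (by positivity) hB
  · positivity
  · have h1 : (n : ℝ) + 1 ≤ 2 * (r : ℝ) + n + 1 := by linarith
    exact h1.trans (le_mul_of_one_le_right (by positivity) hA)

theorem hasSum_dixon {x : ℝ} (hx : 0 ≤ x) (hx1 : x ≤ 1) (r : ℕ) :
    HasSum (dixon x (r + 1)) 1 := by
  have hstep : ∀ r, HasSum (fun n => dixon x r (n + 1)) (1 + dixonAux x r 0) →
      HasSum (dixon x (r + 1)) 1 := by
    intro r hr
    have hs : Summable (dixon x (r + 1)) := by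
      rw [← summable_nat_add_iff 1]
      exact Summable.of_abs (Summable.of_nonneg_of_le (fun _ => abs_nonneg _)
        (fun n => abs_dixon_le hx hx1 (r + 1) n)
        ((summable_inv_succ_pow le_rfl).mul_left _))
    have h1 := hs.hasSum.tendsto_sum_nat
    have h2 := (hr.tendsto_sum_nat.add (tendsto_dixonAux hx hx1 r)).sub_const (dixonAux x r 0)
    have h3 := tendsto_nhds_unique h1 (h2.congr fun N => ?_)
    · refine hs.hasSum.of_eq (fun _ => rfl) ?_
      linarith
    · have : ∑ n ∈ range N, (dixon x (r + 1) n - dixon x r (n + 1))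
          = dixonAux x r N - dixonAux x r 0 := by
        rw [Finset.sum_congr rfl fun n _ => dixon_succ_sub hx r n, Finset.sum_range_sub]
      rw [Finset.sum_sub_distrib] at this
      linarith
  induction r with
  | zero =>
    apply hstep
    have h0 := succ_mul_pochUp_succ x 0
    have : 1 + dixonAux x 0 0 = 0 := by
      simp [dixonAux] at h0 ⊢
      rw [h0, ← neg_add_rev, neg_div, div_self (by positivity)]
      ring
    rw [this]
    exact hasSum_zero.of_eq (fun n => by simp [dixon]) rfl
  | succ r ih =>
    apply hstep
    refine ((hasSum_nat_add_iff' 1).mpr ih).of_eq (fun _ => rfl) ?_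
    have h1 := succ_mul_pochUp_succ x (2 * (r + 1))
    rw [Finset.sum_range_one, dixon, dixonAux]
    have hA := pochUp_pos (by linarith : -1 < x) (2 * (r + 1))
    have hB : pochUp x (2 * (r + 1) + 1)
        = ((2 * (r + 1) : ℕ) + 1 + x) / ((2 * (r + 1) : ℕ) + 1) * pochUp x (2 * (r + 1)) := by
      field_simp
      linear_combination h1
    simp only [add_zero]
    rw [hB]
    push_cast
    have hd : (0 : ℝ) < 2 * (r + 1) + 1 + x := by positivity
    simp
    field_simp
    ring

/-- The difference `1 / k² - 1 / (k + x)²`. -/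
noncomputable def sqShift (x : ℝ) (k : ℕ) : ℝ := 1 / (k : ℝ) ^ 2 - 1 / ((k : ℝ) + x) ^ 2

theorem sqShift_nonneg {x : ℝ} (hx : 0 ≤ x) (k : ℕ) : 0 ≤ sqShift x (k + 1) := by
  rw [sqShift, sub_nonneg]
  apply one_div_le_one_div_of_le (by positivity)
  gcongr
  linarith

theorem oddShift_nonneg {x : ℝ} (hx : 0 ≤ x) (i : ℕ) : 0 ≤ oddShift x i := by
  rw [oddShift]; positivity

theorem pochKer_nonneg {x : ℝ} (hx : 0 ≤ x) (hx1 : x < 1) (k i : ℕ) : 0 ≤ pochKer x k i :=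
  div_nonneg (mul_nonneg (sq_nonneg _) (pochDown_nonneg hx1 _)) (pochUp_pos (by linarith) _).le

theorem pochKer_le {x : ℝ} (hx : 0 ≤ x) (hx1 : x < 1) (k i : ℕ) : pochKer x k i ≤ i + 1 := by
  have h1 := pochUp_mono hx (show i ≤ k + i by omega)
  have h2 := pochDown_le_one hx hx1 (k - 1 - i)
  have h3 := pochUp_pos (by linarith : -1 < x) i
  have h4 := pochUp_pos (by linarith : -1 < x) (k + i)
  have h5 := pochUp_le hx hx1.le i
  rw [pochKer, div_le_iff₀ h4]
  calc pochUp x i ^ 2 * pochDown x (k - 1 - i) ≤ pochUp x i ^ 2 * 1 := by gcongr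
    _ = pochUp x i * pochUp x i := by ring
    _ ≤ _ := mul_le_mul h5 h1 h3.le (by positivity)

theorem pochKer_div_sub {x : ℝ} (hx : 0 < x) (i n : ℕ) :
    2 * x * pochKer x (i + 1 + (n + 1)) i / ((i + 1 + (n + 1) : ℕ) : ℝ) ^ 3
      - 2 * x * pochKer x (i + 1 + 1 + n) (i + 1) / ((i + 1 + 1 + n : ℕ) : ℝ) ^ 3
      = sqShift x (i + 1) * dixon x (i + 1) (n + 1) := by
  rw [pochKer, pochKer, sqShift, dixon, show i + 1 + (n + 1) - 1 - i = n + 1 by omega,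
    show i + 1 + 1 + n - 1 - (i + 1) = n by omega,
    show i + 1 + (n + 1) + i = 2 * i + n + 2 by ring,
    show i + 1 + 1 + n + (i + 1) = 2 * i + n + 2 + 1 by ring,
    show 2 * (i + 1) + (n + 1) = 2 * i + n + 2 + 1 by ring]
  have h1 := succ_mul_pochUp_succ x i
  have h2 := succ_mul_pochUp_succ x (2 * i + n + 2)
  have h3 := succ_mul_pochNeg_succ_eq x n
  have h4 := succ_mul_pochUp_succ (-x) n
  have hA := pochUp_pos (by linarith : -1 < x) (2 * i + n + 2)
  have hB : pochUp x (2 * i + n + 2 + 1)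
      = ((2 * i + n + 2 : ℕ) + 1 + x) / ((2 * i + n + 2 : ℕ) + 1) * pochUp x (2 * i + n + 2) := by
    field_simp
    linear_combination h2
  have hC : pochNeg x (n + 1) = -x / (n + 1) * pochDown x n := by
    field_simp
    linear_combination h3
  have hD : pochDown x (n + 1) = ((n : ℝ) + 1 - x) / (n + 1) * pochDown x n := by
    rw [pochDown, pochDown]
    field_simp
    linear_combination h4
  have hE : pochUp x (i + 1) = ((i : ℝ) + 1 + x) / (i + 1) * pochUp x i := by
    field_simp
    linear_combination h1
  push_cast at hB ⊢
  rw [hB, hC, hD, hE]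
  generalize pochUp x (2 * i + n + 2) = A at *
  generalize pochUp x i = a at *
  generalize pochDown x n = b at *
  have hd : (0 : ℝ) < 2 * i + n + 2 + 1 + x := by positivity
  field_simp
  ring

theorem pochKer_div_self {x : ℝ} (hx : 0 < x) (i : ℕ) :
    2 * x * pochKer x (i + 1 + 0) i / ((i + 1 + 0 : ℕ) : ℝ) ^ 3
      = sqShift x (i + 1) * dixon x (i + 1) 0 := by
  rw [pochKer, sqShift, dixon, show i + 1 + 0 - 1 - i = 0 by omega,
    show i + 1 + 0 + i = 2 * i + 1 by ring, show 2 * (i + 1) + 0 = 2 * i + 1 + 1 by ring]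
  have h1 := succ_mul_pochUp_succ x i
  have h2 := succ_mul_pochUp_succ x (2 * i + 1)
  have hA := pochUp_pos (by linarith : -1 < x) (2 * i + 1)
  have hB : pochUp x (2 * i + 1 + 1)
      = ((2 * i + 1 : ℕ) + 1 + x) / ((2 * i + 1 : ℕ) + 1) * pochUp x (2 * i + 1) := by
    field_simp
    linear_combination h2
  have hE : pochUp x (i + 1) = ((i : ℝ) + 1 + x) / (i + 1) * pochUp x i := by
    field_simp
    linear_combination h1
  push_cast at hB ⊢
  rw [hB, hE, pochNeg_zero, pochDown_zero]
  generalize pochUp x (2 * i + 1) = A at *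
  generalize pochUp x i = a at *
  have hd : (0 : ℝ) < 2 * i + 1 + 1 + x := by positivity
  field_simp
  ring

theorem pochKer_div_le {x : ℝ} (hx : 0 ≤ x) (hx1 : x < 1) (i n : ℕ) :
    2 * x * pochKer x (i + 1 + n) i / ((i + 1 + n : ℕ) : ℝ) ^ 3
      ≤ 2 * x * (1 / ((i + 1 + n : ℕ) : ℝ) ^ 2) := by
  have h1 := pochKer_le hx hx1 (i + 1 + n) i
  have h2 : pochKer x (i + 1 + n) i ≤ ((i + 1 + n : ℕ) : ℝ) := by
    push_cast
    linarith [(by positivity : (0 : ℝ) ≤ n)]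
  rw [mul_div_assoc]
  refine mul_le_mul_of_nonneg_left ?_ (by positivity)
  have h3 : (0 : ℝ) < ((i + 1 + n : ℕ) : ℝ) := by positivity
  rw [div_le_div_iff₀ (by positivity) (by positivity)]
  nlinarith [pow_pos h3 2]

open Filter Topology in
theorem tendsto_zetaTail : Tendsto (zetaTail 2) atTop (𝓝 0) := by
  have := tendsto_sum_nat_add fun d : ℕ => 1 / ((d + 1 : ℕ) : ℝ) ^ 2
  refine this.congr fun i => ?_
  rw [zetaTail]
  exact tsum_congr fun d => by rw [show d + i + 1 = i + 1 + d by ring]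

open Filter Topology in
theorem exists_hasSum_pochKer {x : ℝ} (hx : 0 < x) (hx1 : x < 1) :
    ∃ V : ℕ → ℝ, (∀ i, HasSum (fun n : ℕ =>
        2 * x * pochKer x (i + 1 + n) i / ((i + 1 + n : ℕ) : ℝ) ^ 3) (V i)) ∧
      ∀ i, HasSum (fun n : ℕ => sqShift x (i + 1 + n)) (V i) := by
  have hnn : ∀ i n : ℕ, 0 ≤ 2 * x * pochKer x (i + 1 + n) i / ((i + 1 + n : ℕ) : ℝ) ^ 3 :=
    fun i n => div_nonneg (mul_nonneg (by positivity) (pochKer_nonneg hx.le hx1 _ _))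
      (by positivity)
  have hV : ∀ i, Summable (fun n : ℕ =>
        2 * x * pochKer x (i + 1 + n) i / ((i + 1 + n : ℕ) : ℝ) ^ 3) := fun i =>
    Summable.of_nonneg_of_le (hnn i) (pochKer_div_le hx.le hx1 i)
      ((hasSum_zetaTail le_rfl i).mul_left (2 * x)).summable
  choose V hV using hV
  refine ⟨V, hV, fun i => ?_⟩
  have hstep : ∀ i, sqShift x (i + 1) = V i - V (i + 1) := by
    intro i
    have h1 := ((hasSum_nat_add_iff' 1).mpr (hV i)).sub (hV (i + 1))
    have h2 := (hasSum_nat_add_iff' 1).mpr ((hasSum_dixon hx.le hx1.le i).mul_left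
      (sqShift x (i + 1)))
    have h3 := h1.unique (h2.of_eq (fun n => pochKer_div_sub hx i n) rfl)
    rw [Finset.sum_range_one, Finset.sum_range_one, pochKer_div_self hx i] at h3
    linarith
  have hlim : Tendsto V atTop (𝓝 0) := by
    have h1 := tendsto_zetaTail.const_mul (2 * x)
    rw [mul_zero] at h1
    exact squeeze_zero (fun i => (hV i).nonneg (hnn i))
      (fun i => hasSum_le (pochKer_div_le hx.le hx1 i) (hV i)
        ((hasSum_zetaTail le_rfl i).mul_left (2 * x))) h1
  refine (hasSum_of_telescope (g := fun d => V (i + d)) (f := fun d => sqShift x (i + 1 + d))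
    (l := 0) (fun d => ?_) (fun d => ?_) ?_).of_eq (fun _ => rfl) (by simp)
  · rw [show i + 1 + d = i + d + 1 by ring, hstep, ← add_assoc]
  · rw [show i + 1 + d = i + d + 1 by ring]
    exact sqShift_nonneg hx.le _
  · simpa only [add_comm i] using (tendsto_add_atTop_iff_nat i).mpr hlim

theorem oddRatio_mem {x : ℝ} (hx : 0 ≤ x) (hx2 : x ≤ 1 / 2) (k : ℕ) :
    0 ≤ oddRatio x k ∧ oddRatio x k ≤ 1 := by
  have h1 : ∀ j ∈ range k, (0 : ℝ) ≤ (2 * (j : ℝ) + 1 - 2 * x) / (2 * (j : ℝ) + 1 + 2 * x) :=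
    fun j _ => div_nonneg (by linarith [(by positivity : (0 : ℝ) ≤ j)]) (by positivity)
  refine ⟨Finset.prod_nonneg h1, Finset.prod_le_one h1 fun j _ => ?_⟩
  rw [div_le_one (by positivity)]
  linarith

theorem exists_hasSum_oddRatio {x : ℝ} (hx : 0 < x) (hx2 : x ≤ 1 / 2) :
    ∃ s, HasSum (fun k : ℕ => 2 * (1 - oddRatio x (k + 1)) / ((k : ℝ) + 1) ^ 3) s ∧
      HasSum (fun k : ℕ => sqShift x (k + 1) * ∑ i ∈ range (k + 1), oddShift x i) s := by
  have hx1 : x < 1 := by linarith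
  obtain ⟨V, hV1, hV2⟩ := exists_hasSum_pochKer hx hx1
  have hs : Summable fun k : ℕ => 2 * (1 - oddRatio x (k + 1)) / ((k : ℝ) + 1) ^ 3 :=
    summable_div_pow_of_le (f := fun k => 2 * (1 - oddRatio x k)) (C := 2) (by norm_num)
      (fun k => by linarith [(oddRatio_mem hx.le hx2 k).2])
      (fun k => by linarith [(oddRatio_mem hx.le hx2 k).1])
  obtain ⟨s, hs⟩ := hs
  refine ⟨s, hs, ?_⟩
  have h1 : HasSum (fun k : ℕ => ∑ i ∈ range k, 2 * x * pochKer x k i / (k : ℝ) ^ 3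
      * oddShift x i) s := by
    rw [← hasSum_nat_add_iff' 1]
    refine hs.of_eq (fun k => ?_) (by simp)
    rw [one_sub_oddRatio hx, Finset.mul_sum, Finset.mul_sum, Finset.sum_div]
    refine Finset.sum_congr rfl fun i _ => ?_
    push_cast
    ring
  have h2 := hasSum_triangle_symm (f := fun i k => 2 * x * pochKer x k i / (k : ℝ) ^ 3
      * oddShift x i)
    (fun i k _ => mul_nonneg (div_nonneg (mul_nonneg (by positivity)
      (pochKer_nonneg hx.le hx1 _ _)) (by positivity)) (oddShift_nonneg hx.le _))
    (fun i => (hV1 i).mul_right (oddShift x i)) h1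
  have h3 := hasSum_triangle (f := fun i k => sqShift x k * oddShift x i)
    (fun i k hik => mul_nonneg (by
      obtain ⟨n, rfl⟩ := Nat.exists_eq_add_of_lt hik
      exact sqShift_nonneg hx.le _) (oddShift_nonneg hx.le _))
    (fun i => (hV2 i).mul_right (oddShift x i)) h2
  refine ((hasSum_nat_add_iff' 1).mpr h3).of_eq (fun k => ?_) (by simp)
  rw [Finset.mul_sum]

theorem h3_le_h_pow_three (k : ℕ) : h3 k ≤ h k ^ 3 := by
  induction k with
  | zero => simp
  | succ k ih =>
    rw [h3_succ, h_succ]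
    have h0 := h_nonneg k
    have h1 : (0 : ℝ) ≤ 1 / (2 * (k : ℝ) + 1) := by positivity
    have e : 1 / (2 * (k : ℝ) + 1) ^ 3 = (1 / (2 * (k : ℝ) + 1)) ^ 3 := by rw [one_div_pow]
    rw [e]
    have h2 : 0 ≤ 3 * h k * (1 / (2 * (k : ℝ) + 1)) * (h k + 1 / (2 * (k : ℝ) + 1)) := by positivity
    nlinarith

theorem abs_oddRatio_sub_le {x : ℝ} (hx : 0 ≤ x) (hx2 : x ≤ 1 / 2) (k : ℕ) :
    |oddRatio x k - (1 - 4 * x * h k + 8 * x ^ 2 * h k ^ 2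
      - x ^ 3 * (32 / 3 * h k ^ 3 + 16 / 3 * h3 k))| ≤ 64 * x ^ 4 * h k ^ 4 := by
  induction k with
  | zero => simp [oddRatio]
  | succ k ih =>
    set e := oddRatio x k - (1 - 4 * x * h k + 8 * x ^ 2 * h k ^ 2
      - x ^ 3 * (32 / 3 * h k ^ 3 + 16 / 3 * h3 k)) with he
    have hk : (0 : ℝ) ≤ k := by positivity
    have hu0 : 0 ≤ (2 * (k : ℝ) + 1 - 2 * x) / (2 * (k : ℝ) + 1 + 2 * x) :=
      div_nonneg (by linarith) (by positivity)
    have hu1 : (2 * (k : ℝ) + 1 - 2 * x) / (2 * (k : ℝ) + 1 + 2 * x) ≤ 1 := by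
      rw [div_le_one (by positivity)]
      linarith
    have hstep : oddRatio x (k + 1) - (1 - 4 * x * h (k + 1) + 8 * x ^ 2 * h (k + 1) ^ 2
        - x ^ 3 * (32 / 3 * h (k + 1) ^ 3 + 16 / 3 * h3 (k + 1)))
        = (2 * (k : ℝ) + 1 - 2 * x) / (2 * (k : ℝ) + 1 + 2 * x) * e
          + 2 * x ^ 4 * ((32 / 3 * h k ^ 3 + 16 / 3 * h3 k)
            + (32 / 3 * h (k + 1) ^ 3 + 16 / 3 * h3 (k + 1))) / (2 * (k : ℝ) + 1 + 2 * x) := by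
      rw [he, oddRatio_succ, h_succ, h3_succ]
      field_simp
      ring
    have hm := h_mono (Nat.le_succ k)
    have h0 := h_nonneg k
    have hB1 := h3_le_h_pow_three k
    have hB2 := h3_le_h_pow_three (k + 1)
    have hB3 : h k ^ 3 ≤ h (k + 1) ^ 3 := by gcongr
    have hn1 := h3_nonneg k
    have hn2 := h3_nonneg (k + 1)
    have hn3 := h_nonneg (k + 1)
    have hr : |2 * x ^ 4 * ((32 / 3 * h k ^ 3 + 16 / 3 * h3 k)
            + (32 / 3 * h (k + 1) ^ 3 + 16 / 3 * h3 (k + 1))) / (2 * (k : ℝ) + 1 + 2 * x)|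
        ≤ 2 * x ^ 4 * (32 * h (k + 1) ^ 3) / (2 * (k : ℝ) + 1) := by
      rw [abs_of_nonneg (by positivity)]
      apply div_le_div₀ (by positivity) _ (by positivity) (by linarith)
      exact mul_le_mul_of_nonneg_left (by linarith) (by positivity)
    have hpow : h k ^ 4 + h (k + 1) ^ 3 / (2 * (k : ℝ) + 1) ≤ h (k + 1) ^ 4 := by
      have e1 : h (k + 1) ^ 3 / (2 * (k : ℝ) + 1) = h (k + 1) ^ 3 * (h (k + 1) - h k) := by
        rw [h_succ k]; ring
      rw [e1]
      have : h k * h k ^ 3 ≤ h k * h (k + 1) ^ 3 := mul_le_mul_of_nonneg_left hB3 h0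
      nlinarith
    rw [hstep]
    refine (abs_add_le _ _).trans ?_
    rw [abs_mul, abs_of_nonneg hu0]
    have h5 : (2 * (k : ℝ) + 1 - 2 * x) / (2 * (k : ℝ) + 1 + 2 * x) * |e| ≤ |e| :=
      mul_le_of_le_one_left (abs_nonneg _) hu1
    have h6 := mul_le_mul_of_nonneg_left hpow (by positivity : 0 ≤ 64 * x ^ 4)
    have h7 : 2 * x ^ 4 * (32 * h (k + 1) ^ 3) / (2 * (k : ℝ) + 1)
      = 64 * x ^ 4 * (h (k + 1) ^ 3 / (2 * (k : ℝ) + 1)) := by ring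
    linarith

theorem sum_oddShift_le {x : ℝ} (hx : 0 ≤ x) (k : ℕ) :
    ∑ i ∈ range k, oddShift x i ≤ 4 * h k := by
  rw [h, Finset.mul_sum]
  refine Finset.sum_le_sum fun i _ => ?_
  have : 2 / (2 * (i : ℝ) + 1 + 2 * x) ≤ 2 / (2 * (i : ℝ) + 1) :=
    div_le_div_of_nonneg_left (by positivity) (by positivity) (by linarith)
  rw [oddShift]
  have e : 4 * (1 / (2 * (i : ℝ) + 1)) = 2 / (2 * (i : ℝ) + 1) + 2 / (2 * (i : ℝ) + 1) := by ring
  linarith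

theorem abs_sum_oddShift_sub_le {x : ℝ} (hx : 0 ≤ x) (k : ℕ) :
    |∑ i ∈ range k, oddShift x i - (4 * h k - 4 * x * h2 k + 8 * x ^ 2 * h3 k)|
      ≤ 16 * x ^ 3 * h k := by
  have e : ∑ i ∈ range k, oddShift x i - (4 * h k - 4 * x * h2 k + 8 * x ^ 2 * h3 k)
      = ∑ i ∈ range k, -(16 * x ^ 3 / ((2 * (i : ℝ) + 1) ^ 3 * (2 * (i : ℝ) + 1 + 2 * x))) := by
    rw [h, h2, h3, Finset.mul_sum, Finset.mul_sum, Finset.mul_sum, ← Finset.sum_sub_distrib,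
      ← Finset.sum_add_distrib, ← Finset.sum_sub_distrib]
    refine Finset.sum_congr rfl fun i _ => ?_
    rw [oddShift]
    field_simp
    ring
  rw [e, h, Finset.mul_sum]
  refine (Finset.abs_sum_le_sum_abs _ _).trans (Finset.sum_le_sum fun i _ => ?_)
  rw [abs_neg, abs_of_nonneg (by positivity), mul_one_div]
  apply div_le_div_of_nonneg_left (by positivity) (by positivity)
  have hi : (0 : ℝ) ≤ i := by positivity
  have h1 : (1 : ℝ) ≤ (2 * (i : ℝ) + 1) ^ 3 := one_le_pow₀ (by linarith)
  nlinarith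

theorem abs_sqShift_sub_le {x : ℝ} (hx : 0 ≤ x) (k : ℕ) :
    |sqShift x (k + 1) - 1 / ((k : ℝ) + 1) ^ 3 * (2 * x - 3 * x ^ 2 * (1 / ((k : ℝ) + 1))
      + 4 * x ^ 3 * (1 / ((k : ℝ) + 1)) ^ 2)| ≤ 5 * x ^ 4 * (1 / ((k : ℝ) + 1) ^ 3) := by
  have hk : (0 : ℝ) ≤ k := by positivity
  have e : sqShift x (k + 1) - 1 / ((k : ℝ) + 1) ^ 3 * (2 * x - 3 * x ^ 2 * (1 / ((k : ℝ) + 1))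
      + 4 * x ^ 3 * (1 / ((k : ℝ) + 1)) ^ 2)
      = -(x ^ 4 * (5 * ((k : ℝ) + 1) + 4 * x) / (((k : ℝ) + 1) ^ 5 * ((k : ℝ) + 1 + x) ^ 2)) := by
    rw [sqShift]
    push_cast
    field_simp
    ring
  rw [e, abs_neg, abs_of_nonneg (by positivity), mul_one_div, div_le_div_iff₀ (by positivity)
    (by positivity)]
  have h1 : (5 * ((k : ℝ) + 1) + 4 * x) ≤ 5 * (((k : ℝ) + 1) ^ 2 * ((k : ℝ) + 1 + x) ^ 2) := by
    have a1 : (1 : ℝ) ≤ ((k : ℝ) + 1) ^ 2 := one_le_pow₀ (by linarith)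
    have a2 : (k : ℝ) + 1 + x ≤ ((k : ℝ) + 1 + x) ^ 2 := by nlinarith
    have a3 : ((k : ℝ) + 1 + x) ^ 2 ≤ ((k : ℝ) + 1) ^ 2 * ((k : ℝ) + 1 + x) ^ 2 :=
      le_mul_of_one_le_left (by positivity) a1
    nlinarith
  have h2 := mul_le_mul_of_nonneg_left h1 (by positivity : 0 ≤ x ^ 4 * ((k : ℝ) + 1) ^ 3)
  nlinarith

theorem abs_taylor_remainder_le {x u κ a b c P D y : ℝ} (hx : 0 ≤ x) (hx1 : x ≤ 1) (hu : 0 ≤ u)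
    (hu1 : u ≤ 1) (hκ : 0 ≤ κ) (hb : 0 ≤ b) (hba : b ≤ a) (hc : 0 ≤ c) (hca : c ≤ a)
    (hP : |P - (1 - 4 * x * a + 8 * x ^ 2 * a ^ 2 - x ^ 3 * (32 / 3 * a ^ 3 + 16 / 3 * c))|
      ≤ 64 * x ^ 4 * a ^ 4)
    (hD0 : 0 ≤ D) (hD4 : D ≤ 4 * a)
    (hD : |D - (4 * a - 4 * x * b + 8 * x ^ 2 * c)| ≤ 16 * x ^ 3 * a)
    (hy : |y - κ * (2 * x - 3 * x ^ 2 * u + 4 * x ^ 3 * u ^ 2)| ≤ 5 * x ^ 4 * κ) :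
    |2 * κ * (1 - P) - y * D
      - (x ^ 2 * (κ * (-16 * a ^ 2 + 8 * b + 12 * u * a))
        + x ^ 3 * (κ * (64 / 3 * a ^ 3 - 16 / 3 * c - 12 * u * b - 16 * u ^ 2 * a)))|
      ≤ x ^ 4 * (κ * (128 * a ^ 4 + 236 * a)) := by
  have ha : 0 ≤ a := hb.trans hba
  set e1 := P - (1 - 4 * x * a + 8 * x ^ 2 * a ^ 2 - x ^ 3 * (32 / 3 * a ^ 3 + 16 / 3 * c)) with he1
  set e2 := D - (4 * a - 4 * x * b + 8 * x ^ 2 * c) with he2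
  set e3 := y - κ * (2 * x - 3 * x ^ 2 * u + 4 * x ^ 3 * u ^ 2) with he3
  set p := 2 * x - 3 * x ^ 2 * u + 4 * x ^ 3 * u ^ 2 with hp
  have hu2 : u ^ 2 ≤ 1 := pow_le_one₀ hu hu1
  have hx2 : x ^ 2 ≤ x := by nlinarith
  have hx3 : x ^ 3 ≤ x := by nlinarith
  have b1 : |2 * κ * e1| ≤ 2 * κ * (64 * x ^ 4 * a ^ 4) := by
    rw [abs_mul, abs_of_nonneg (by positivity : 0 ≤ 2 * κ)]
    gcongr
  have b2 : |e3 * D| ≤ 5 * x ^ 4 * κ * (4 * a) := by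
    rw [abs_mul, abs_of_nonneg hD0]
    gcongr
  have q1 : x ^ 2 * u ≤ x := (mul_le_of_le_one_right (by positivity) hu1).trans hx2
  have q2 : x ^ 3 * u ^ 2 ≤ x := (mul_le_of_le_one_right (by positivity) hu2).trans hx3
  have q3 : 0 ≤ x ^ 2 * u := by positivity
  have q4 : 0 ≤ x ^ 3 * u ^ 2 := by positivity
  have b3 : |κ * p * e2| ≤ κ * (9 * x) * (16 * x ^ 3 * a) := by
    rw [abs_mul, abs_mul, abs_of_nonneg hκ]
    have : |p| ≤ 9 * x := by
      rw [abs_le, hp]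
      constructor <;> linarith
    gcongr
  have b4 : |-24 * c * u - 16 * b * u ^ 2 + 32 * x * c * u ^ 2| ≤ 72 * a := by
    have r1 : c * u ≤ a := (mul_le_of_le_one_right hc hu1).trans hca
    have r2 : b * u ^ 2 ≤ a := (mul_le_of_le_one_right hb hu2).trans hba
    have r3 : x * c * u ^ 2 ≤ a :=
      (mul_le_of_le_one_right (by positivity) hu2).trans
        ((mul_le_of_le_one_left hc hx1).trans hca)
    have r4 : 0 ≤ c * u := by positivity
    have r5 : 0 ≤ b * u ^ 2 := by positivity
    have r6 : 0 ≤ x * c * u ^ 2 := by positivity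
    rw [abs_le]
    constructor <;> linarith
  have b5 : |κ * x ^ 4 * (-24 * c * u - 16 * b * u ^ 2 + 32 * x * c * u ^ 2)|
      ≤ κ * x ^ 4 * (72 * a) := by
    rw [abs_mul, abs_of_nonneg (by positivity : 0 ≤ κ * x ^ 4)]
    gcongr
  have e : 2 * κ * (1 - P) - y * D
      - (x ^ 2 * (κ * (-16 * a ^ 2 + 8 * b + 12 * u * a))
        + x ^ 3 * (κ * (64 / 3 * a ^ 3 - 16 / 3 * c - 12 * u * b - 16 * u ^ 2 * a)))
      = -(2 * κ * e1) - e3 * D - κ * p * e2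
        - κ * x ^ 4 * (-24 * c * u - 16 * b * u ^ 2 + 32 * x * c * u ^ 2) := by
    rw [he1, he2, he3, hp]
    ring
  rw [e]
  clear_value e1 e2 e3 p
  rw [abs_le] at b1 b2 b3 b5 ⊢
  constructor
  · linarith [b1.2, b2.2, b3.2, b5.2]
  · linarith [b1.1, b2.1, b3.1, b5.1]

theorem eq_zero_of_abs_le_sq {c d M : ℝ}
    (hM : ∀ x : ℝ, 0 < x → x ≤ 1 / 2 → |x ^ 2 * c + x ^ 3 * d| ≤ x ^ 4 * M) : d = 0 := by
  have h1 : ∀ x : ℝ, 0 < x → x ≤ 1 / 2 → |c + x * d| ≤ x ^ 2 * M := by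
    intro x hx hx2
    have := hM x hx hx2
    rw [show x ^ 2 * c + x ^ 3 * d = x ^ 2 * (c + x * d) by ring, abs_mul,
      abs_of_pos (by positivity), show x ^ 4 * M = x ^ 2 * (x ^ 2 * M) by ring] at this
    exact le_of_mul_le_mul_left this (by positivity)
  have hM0 : 0 ≤ M := by
    have := (abs_nonneg _).trans (h1 (1 / 2) (by norm_num) le_rfl)
    linarith
  have h2 : ∀ x : ℝ, 0 < x → x ≤ 1 / 2 → |d| ≤ x * (4 * M) := by
    intro x hx hx2
    have a1 := h1 x hx hx2
    have a2 := h1 (x / 2) (by positivity) (by linarith)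
    have a3 : |x * d| ≤ x * (x * (4 * M)) := by
      rw [abs_le] at a1 a2 ⊢
      constructor <;> nlinarith [mul_nonneg (sq_nonneg x) hM0]
    rw [abs_mul, abs_of_pos hx] at a3
    exact le_of_mul_le_mul_left a3 hx
  by_contra hd
  have hd' : 0 < |d| := abs_pos.mpr hd
  have hx0 : 0 < min (1 / 2) (|d| / (8 * M + 1)) := lt_min (by norm_num) (by positivity)
  have a1 := h2 _ hx0 (min_le_left _ _)
  have a2 : min (1 / 2) (|d| / (8 * M + 1)) * (4 * M) ≤ |d| / (8 * M + 1) * (4 * M) := by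
    gcongr
    exact min_le_right _ _
  have a3 : |d| / (8 * M + 1) * (4 * M) < |d| := by
    rw [div_mul_eq_mul_div, div_lt_iff₀ (by positivity)]
    nlinarith
  linarith

theorem summable_h_pow_three_div :
    Summable fun k : ℕ => h (k + 1) ^ 3 / ((k : ℝ) + 1) ^ 3 := by
  refine Summable.of_nonneg_of_le (fun n => by have := h_nonneg (n + 1); positivity) (fun n => ?_)
    hasSum_h_sq_div_sq.summable
  have h1 := h_le (n + 1)
  push_cast at h1
  rw [div_le_div_iff₀ (by positivity) (by positivity)]
  have : 0 ≤ h (n + 1) ^ 2 * ((n : ℝ) + 1) ^ 2 := by positivity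
  nlinarith

theorem summable_h_pow_four_div :
    Summable fun k : ℕ => h (k + 1) ^ 4 / ((k : ℝ) + 1) ^ 3 := by
  refine Summable.of_nonneg_of_le (fun n => by positivity) (fun n => ?_)
    hasSum_h_sq_div_sq.summable
  have h1 := h_sq_le (n + 1)
  push_cast at h1
  rw [div_le_div_iff₀ (by positivity) (by positivity)]
  have : 0 ≤ h (n + 1) ^ 2 * ((n : ℝ) + 1) ^ 2 := by positivity
  nlinarith

theorem hasSum_h_pow_three_div {b v q r : ℝ}
    (hb : HasSum (fun k : ℕ => h (k + 1) ^ 3 / ((k : ℝ) + 1) ^ 3) b)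
    (hv : HasSum (fun k : ℕ => h3 (k + 1) / ((k : ℝ) + 1) ^ 3) v)
    (hq : HasSum (fun k : ℕ => h2 (k + 1) / ((k : ℝ) + 1) ^ 4) q)
    (hr : HasSum (fun k : ℕ => h (k + 1) / ((k : ℝ) + 1) ^ 5) r) :
    16 * b = 4 * v + 9 * q + 12 * r := by
  obtain ⟨w, hw⟩ : Summable fun k : ℕ => h (k + 1) ^ 2 / ((k : ℝ) + 1) ^ 3 := by
    refine Summable.of_nonneg_of_le (fun n => by positivity) (fun n => ?_)
      hasSum_h_sq_div_sq.summable
    apply div_le_div_of_nonneg_left (sq_nonneg _) (by positivity)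
    exact pow_le_pow_right₀ (by linarith [(by positivity : (0 : ℝ) ≤ n)]) (by norm_num)
  obtain ⟨w2, hw2⟩ := summable_div_pow_of_le (s := 3) (by norm_num) h2_nonneg h2_le
  obtain ⟨w3, hw3⟩ := summable_h_div_pow (s := 4) (by norm_num)
  obtain ⟨w4, hw4⟩ := summable_h_div_pow (s := 3) (by norm_num)
  obtain ⟨w5, hw5⟩ := summable_h_pow_four_div
  have hc := ((hw.mul_left (-16)).add (hw2.mul_left 8)).add (hw3.mul_left 12)
  have hd := (((hb.mul_left (64 / 3)).sub (hv.mul_left (16 / 3))).sub (hq.mul_left 12)).sub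
    (hr.mul_left 16)
  have hM := (hw5.mul_left 128).add (hw4.mul_left 236)
  have key : 64 / 3 * b - 16 / 3 * v - 12 * q - 16 * r = 0 := by
    refine eq_zero_of_abs_le_sq (c := -16 * w + 8 * w2 + 12 * w3) (M := 128 * w5 + 236 * w4)
      fun x hx hx2 => ?_
    obtain ⟨s, hs1, hs2⟩ := exists_hasSum_oddRatio hx hx2
    have h1 := (hs1.sub hs2).sub ((hc.mul_left (x ^ 2)).add (hd.mul_left (x ^ 3)))
    rw [sub_self, zero_sub] at h1
    have h2' := hM.mul_left (x ^ 4)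
    have hle : ∀ k : ℕ, _ := fun k => abs_taylor_remainder_le (u := 1 / ((k : ℝ) + 1))
      (κ := 1 / ((k : ℝ) + 1) ^ 3) hx.le (by linarith)
      (by positivity) (by
        rw [div_le_one (by positivity)]
        linarith [(by positivity : (0 : ℝ) ≤ k)]) (by positivity) (h2_nonneg (k + 1)) (h2_le_h _)
      (h3_nonneg (k + 1)) ((h3_le_h2 _).trans (h2_le_h _)) (abs_oddRatio_sub_le hx.le hx2 (k + 1))
      (Finset.sum_nonneg fun i _ => oddShift_nonneg hx.le i) (sum_oddShift_le hx.le (k + 1))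
      (abs_sum_oddShift_sub_le hx.le (k + 1)) (abs_sqShift_sub_le hx.le k)
    rw [← abs_neg, abs_le]
    constructor
    · rw [neg_le_iff_add_nonneg]
      refine (h1.add h2').nonneg fun k => ?_
      have := (abs_le.mp (hle k)).1
      rw [neg_le_iff_add_nonneg] at this
      refine this.trans_eq ?_
      field_simp
    · refine hasSum_le (fun k => ?_) h1 h2'
      have := (abs_le.mp (hle k)).2
      refine (Eq.trans_le ?_ this).trans_eq ?_
      · field_simp
      · field_simp
  linarith

theorem zeta_six : zeta 6 = π ^ 6 / 945 := by
  have h6 : HasSum (fun n : ℕ => 1 / (n : ℝ) ^ 6) (π ^ 6 / 945) := by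
    refine (hasSum_zeta_nat (k := 3) (by norm_num)).of_eq (fun n => by norm_num) ?_
    have hb : bernoulli 6 = 1 / 42 := by
      rw [bernoulli_eq_bernoulli'_of_ne_one (by norm_num), bernoulli'_def]
      norm_num [Finset.sum_range_succ, Nat.choose,
        bernoulli'_eq_zero_of_odd (show Odd 5 by decide)
          (by norm_num)]
    norm_num [hb, Nat.factorial]
    ring
  refine (hasSum_zeta (by norm_num)).unique ?_
  have := (hasSum_nat_add_iff' 1).mpr h6
  simpa using this

theorem summable_h_mul_h2_div_pow_three :
    Summable fun k : ℕ => h (k + 1) * h2 (k + 1) / ((k : ℝ) + 1) ^ 3 := by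
  refine Summable.of_nonneg_of_le
    (fun n => by have := h_nonneg (n + 1); have := h2_nonneg (n + 1); positivity) (fun n => ?_)
    ((summable_h_div_pow (s := 3) (by norm_num)).mul_right 2)
  rw [div_mul_eq_mul_div]
  have := h_nonneg (n + 1)
  have := h2_le (n + 1)
  gcongr

theorem stmt12 :
    HasSum (fun k : ℕ => h2 (k + 1) * (h (k + 1)) ^ 2 / ((k : ℝ) + 1) ^ 2)
      ((135 / 64) * zeta 6 + (7 / 8) * (zeta 3) ^ 2) := by
  obtain ⟨v, hv⟩ := summable_div_pow_of_le (s := 3) (by norm_num) h3_nonneg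
    fun k => (h3_le_h2 k).trans (h2_le k)
  obtain ⟨q, hq⟩ := summable_div_pow_of_le (s := 4) (by norm_num) h2_nonneg h2_le
  obtain ⟨r, hr⟩ := summable_h_div_pow (s := 5) (by norm_num)
  obtain ⟨x, hx⟩ := summable_div_pow_of_le (s := 2) (by norm_num) h4_nonneg
    fun k => (h4_le_h2 k).trans (h2_le k)
  obtain ⟨b, hb⟩ := summable_h_pow_three_div
  obtain ⟨c, hc⟩ := summable_h_mul_h2_div_pow_three
  have hw := hasSum_h_sq_div_pow_four
  have e1 := hasSum_h_mul_h2_div_pow_three hc hw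
  have e2 := hasSum_h_pow_three_div hb hv hq hr
  have e3 := hasSum_shuffle_two_four.unique ((((hx.div_const 4).add (hv.div_const 4)).add
    (hq.div_const 4)).add (hr.div_const 4) |>.of_eq (fun k => by field_simp) rfl)
  have e4 := hasSum_shuffle_three_three.unique (((hv.div_const 4).add
    (hq.mul_left (3 / 8))).add (hr.mul_left (3 / 8)) |>.of_eq (fun k => by field_simp) rfl)
  have e5 : 4 / 3 * (b - 3 * c + 2 * v) = 2 * (2 * zeta 2 * (2 * (3 / 4 * zeta 2) ^ 2)
      - 2 * (7 / 4 * zeta 3) ^ 2 - q) := by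
    have d1 : HasSum (fun k : ℕ => oddElem (2 + 1) (k + 1) / ((k : ℝ) + 1) ^ (1 + 2))
        (4 / 3 * (b - 3 * c + 2 * v)) :=
      (((hb.sub (hc.mul_left 3)).add (hv.mul_left 2)).mul_left (4 / 3)).of_eq
        (fun k => by rw [oddElem_three]; ring) rfl
    refine (hasSum_oddElem_duality 1 2 d1).unique
      (((hw.sub hq).mul_left 2).of_eq (fun k => ?_) rfl)
    rw [oddElem_two]
    ring
  refine (hasSum_target_of_values hv hq hx).of_eq (fun _ => rfl) ?_
  rw [zeta_two] at *
  rw [zeta_four] at *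
  rw [zeta_six]
  linarith
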